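/- arXiv:2007.05809 — 12 statements merged into one kernel-verified Lean document; each statement's English description precedes it below -/
import Mathlib

section
/- Let n and m be nonnegative integers with n > m, let τ > 0, and let a_0, …, a_{n-1}, b_0, …, b_m be real numbers. Then the quasipolynomial Δ(s) = s^n + Σ_{k=0}^{n-1} a_k s^k + e^{-sτ} Σ_{k=0}^{m} b_k s^k admits no root of multiplicity larger than n + m + 1; that is, there is no s_0 ∈ ℂ such that Δ^{(k)}(s_0) = 0 for all k = 0, 1, …, n + m + 1. -/
open Complex Finset

namespace Polynomial

theorem iteratedDeriv_eval_add_exp_mul_eval (c : ℂ) (P Q : ℂ[X]) (k : ℕ) :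
    iteratedDeriv k (fun s : ℂ => P.eval s + Complex.exp (c * s) * Q.eval s) =
      fun s => (derivative^[k] P).eval s +
        Complex.exp (c * s) * ((fun R : ℂ[X] => derivative R + C c * R)^[k] Q).eval s := by
  induction k generalizing P Q with
  | zero => simp
  | succ k ih =>
    have hderiv : deriv (fun s : ℂ => P.eval s + Complex.exp (c * s) * Q.eval s) =
        fun s => (derivative P).eval s +
          Complex.exp (c * s) * (derivative Q + C c * Q).eval s := by
      funext s
      have hexp : HasDerivAt (fun s : ℂ => Complex.exp (c * s)) (Complex.exp (c * s) * c) s := by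
        simpa using ((hasDerivAt_id s).const_mul c).cexp
      refine ((P.hasDerivAt s).add (hexp.mul (Q.hasDerivAt s))).deriv.trans ?_
      simp only [eval_add, eval_mul, eval_C]
      ring
    rw [iteratedDeriv_succ', hderiv, ih, Function.iterate_succ_apply, Function.iterate_succ_apply]

variable {K : Type*}

theorem degree_derivative_add_C_mul [CommRing K] [IsDomain K] {c : K} (hc : c ≠ 0) (Q : K[X]) :
    (derivative Q + C c * Q).degree = Q.degree := by
  rcases eq_or_ne Q 0 with rfl | hQ
  · simp
  · have h : (C c * Q).degree = Q.degree := degree_C_mul hc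
    rw [degree_add_eq_right_of_degree_lt (by rw [h]; exact degree_derivative_lt hQ), h]

theorem degree_iterate_derivative_add_C_mul [CommRing K] [IsDomain K] {c : K} (hc : c ≠ 0)
    (Q : K[X]) (k : ℕ) :
    ((fun R : K[X] => derivative R + C c * R)^[k] Q).degree = Q.degree := by
  induction k generalizing Q with
  | zero => rfl
  | succ k ih => rw [Function.iterate_succ_apply, ih, degree_derivative_add_C_mul hc]

theorem eval_iterate_derivative_eq_zero_of_iterate_derivative_add_C_mul [CommRing K] {c x : K}
    {k : ℕ} {R : K[X]}
    (h : ∀ j ≤ k, ((fun R : K[X] => derivative R + C c * R)^[j] R).eval x = 0) :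
    (derivative^[k] R).eval x = 0 := by
  induction k generalizing R with
  | zero => simpa using h 0 le_rfl
  | succ k ih =>
    have hR := ih fun j hj => h j (by lia)
    have hLR := ih (R := derivative R + C c * R) fun j hj => by
      simpa only [Function.iterate_succ_apply] using h (j + 1) (by lia)
    rw [iterate_map_add, iterate_derivative_C_mul, eval_add, eval_C_mul, hR, mul_zero,
      add_zero] at hLR
    rwa [Function.iterate_succ_apply]

theorem eq_zero_of_eval_iterate_derivative_eq_zero [CommRing K] [IsDomain K] [CharZero K] {R : K[X]}
    {x : K} {d : ℕ} (hd : R.natDegree ≤ d) (h : ∀ j ≤ d, (derivative^[j] R).eval x = 0) :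
    R = 0 := by
  by_contra hR
  have hlt := (lt_rootMultiplicity_iff_isRoot_iterate_derivative (t := x) (n := d) hR).2 h
  have hle : R.rootMultiplicity x ≤ R.natDegree := by
    classical
    rw [← count_roots]
    exact (Multiset.count_le_card _ _).trans R.card_roots'
  lia

/-- A quasipolynomial `P(s) + e^{cs} Q(s)` with `c ≠ 0` that vanishes at a point to order greater
than `deg P + deg Q + 1` is trivial. -/
theorem eq_zero_and_eq_zero_of_iteratedDeriv_eq_zero {c : ℂ} (hc : c ≠ 0) {P Q : ℂ[X]} {n m : ℕ}
    (hP : P.natDegree ≤ n) (hQ : Q.natDegree ≤ m) {x : ℂ}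
    (h : ∀ k ≤ n + m + 1,
      iteratedDeriv k (fun s : ℂ => P.eval s + Complex.exp (c * s) * Q.eval s) x = 0) :
    P = 0 ∧ Q = 0 := by
  simp only [iteratedDeriv_eval_add_exp_mul_eval] at h
  have hQ0 : Q = 0 := by
    have hdeg := degree_iterate_derivative_add_C_mul hc Q (n + 1)
    rw [← degree_eq_bot, ← hdeg, degree_eq_bot]
    refine eq_zero_of_eval_iterate_derivative_eq_zero (x := x) (d := m)
      ((natDegree_eq_of_degree_eq hdeg).trans_le hQ) fun k hk =>
      eval_iterate_derivative_eq_zero_of_iterate_derivative_add_C_mul (c := c) fun j hj => ?_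
    have hj' := h (j + (n + 1)) (by lia)
    rwa [iterate_derivative_eq_zero (by lia), eval_zero, zero_add, Function.iterate_add_apply,
      mul_eq_zero_iff_left (Complex.exp_ne_zero _)] at hj'
  subst hQ0
  refine ⟨eq_zero_of_eval_iterate_derivative_eq_zero (x := x) hP fun j hj => ?_, rfl⟩
  have hL : (fun R : ℂ[X] => derivative R + C c * R)^[j] 0 = 0 := by
    rw [← degree_eq_bot, degree_iterate_derivative_add_C_mul hc, degree_zero]
  simpa [hL] using h j (by lia)

end Polynomial

/-- A quasipolynomial `Δ(s) = sⁿ + Σ_{k<n} aₖ sᵏ + e^{-sτ} Σ_{k≤m} bₖ sᵏ` of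
retarded type (`n > m`) admits no root of multiplicity larger than `n + m + 1`. -/
theorem no_root_of_multiplicity_gt_nmp1 (n m : ℕ) (hnm : m < n) (τ : ℝ) (hτ : 0 < τ)
    (a b : ℕ → ℝ) :
    ¬ ∃ s₀ : ℂ, ∀ k : ℕ, k ≤ n + m + 1 →
      iteratedDeriv k
        (fun s : ℂ => s ^ n + (∑ k ∈ Finset.range n, (a k : ℂ) * s ^ k)
          + Complex.exp (-s * τ) * ∑ k ∈ Finset.range (m + 1), (b k : ℂ) * s ^ k) s₀ = 0 := by
  rintro ⟨s₀, h⟩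
  let p : Polynomial ℂ := ∑ k ∈ range n, Polynomial.C (a k : ℂ) * Polynomial.X ^ k
  let Q : Polynomial ℂ := ∑ k ∈ range (m + 1), Polynomial.C (b k : ℂ) * Polynomial.X ^ k
  have hp : p.degree < n := by
    refine (Polynomial.degree_sum_le _ _).trans_lt ((Finset.sup_lt_iff (WithBot.bot_lt_coe n)).2
      fun k hk => (Polynomial.degree_C_mul_X_pow_le _ _).trans_lt ?_)
    exact Nat.cast_lt.2 (mem_range.1 hk)
  have hQ : Q.natDegree ≤ m := Polynomial.natDegree_sum_le_of_forall_le _ _ fun k hk =>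
    (Polynomial.natDegree_C_mul_X_pow_le _ _).trans (Nat.lt_succ_iff.1 (mem_range.1 hk))
  have hmonic : (Polynomial.X ^ n + p).Monic := Polynomial.monic_X_pow_add hp
  have hP : (Polynomial.X ^ n + p).natDegree ≤ n :=
    Polynomial.natDegree_add_le_of_degree_le (Polynomial.natDegree_X_pow_le n)
      (Polynomial.natDegree_le_of_degree_le hp.le)
  refine hmonic.ne_zero (Polynomial.eq_zero_and_eq_zero_of_iteratedDeriv_eq_zero
    (c := -(τ : ℂ)) (by simpa using hτ.ne') hP hQ (x := s₀) fun k hk => ?_).1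
  rw [← h k hk]
  congr 1
  funext s
  simp only [p, Q, Polynomial.eval_add, Polynomial.eval_pow, Polynomial.eval_X,
    Polynomial.eval_finsetSum, Polynomial.eval_mul, Polynomial.eval_C]
  rw [neg_mul_comm, mul_comm (τ : ℂ)]
end

section
/- Let n and m be nonnegative integers with n > m, let τ > 0, and let a_0, …, a_{n-1}, b_0, …, b_m be real numbers. Then the quasipolynomial Δ(s) = s^n + Σ_{k=0}^{n-1} a_k s^k + e^{-sτ} Σ_{k=0}^{m} b_k s^k has at most n + m + 1 distinct real roots; that is, any set of distinct real numbers s with Δ(s) = 0 has cardinality at most n + m + 1. -/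
open Complex Finset

/-- Finite form of Rolle's theorem: `k + 1` zeros of `f` yield `k` zeros of its derivative. -/
theorem exists_finset_zeros_of_hasDerivAt {f f' : ℝ → ℝ} (hf : ∀ x, HasDerivAt f (f' x) x)
    (S : Finset ℝ) (hS : ∀ s ∈ S, f s = 0) :
    ∃ T : Finset ℝ, (∀ t ∈ T, f' t = 0) ∧ S.card ≤ T.card + 1 := by
  rcases hk : S.card with _ | k
  · exact ⟨∅, by simp, by simp⟩
  let e := S.orderEmbOfFin hk
  have hrolle (i : Fin k) : ∃ t ∈ Set.Ioo (e i.castSucc) (e i.succ), f' t = 0 := by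
    refine exists_hasDerivAt_eq_zero (e.strictMono Fin.castSucc_lt_succ)
      (fun x _ ↦ (hf x).continuousAt.continuousWithinAt) ?_ (fun x _ ↦ hf x)
    rw [hS _ (S.orderEmbOfFin_mem hk _), hS _ (S.orderEmbOfFin_mem hk _)]
  choose t ht ht0 using hrolle
  have hmono : StrictMono t := fun i j hij ↦
    (ht i).2.trans_le <| (e.monotone (Fin.succ_le_castSucc_iff.2 hij)).trans (ht j).1.le
  refine ⟨univ.image t, by simpa using ht0, ?_⟩
  rw [card_image_of_injective _ hmono.injective, card_univ, Fintype.card_fin]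

/-- If the `N`-th derivative of `P` vanishes and `Q ≠ 0`, then `P(x) + exp(c x) Q(x)` has at most
`N + deg Q` distinct real zeros. -/
theorem card_zeros_add_exp_mul_le {c : ℝ} (hc : c ≠ 0) (N : ℕ) (P Q : Polynomial ℝ)
    (hP : Polynomial.derivative^[N] P = 0) (hQ : Q ≠ 0) (S : Finset ℝ)
    (hS : ∀ s ∈ S, P.eval s + Real.exp (c * s) * Q.eval s = 0) :
    S.card ≤ N + Q.natDegree := by
  induction N generalizing P Q S with
  | zero =>
    obtain rfl : P = 0 := hP
    rw [zero_add]
    refine Polynomial.card_le_degree_of_subset_roots fun s hs ↦ ?_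
    simpa [hQ] using hS s hs
  | succ N ih =>
    set R := Q.derivative + Polynomial.C c * Q with hR
    have hdeg : R.degree = Q.degree := by
      rw [hR, Polynomial.degree_add_eq_right_of_degree_lt, Polynomial.degree_C_mul hc]
      rw [Polynomial.degree_C_mul hc]
      exact Polynomial.degree_derivative_lt hQ
    have hR0 : R ≠ 0 := by
      rwa [← Polynomial.degree_ne_bot, hdeg, Polynomial.degree_ne_bot]
    have hderiv (x : ℝ) : HasDerivAt (fun x ↦ P.eval x + Real.exp (c * x) * Q.eval x)
        (P.derivative.eval x + Real.exp (c * x) * R.eval x) x := by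
      have hexp : HasDerivAt (fun x ↦ Real.exp (c * x)) (Real.exp (c * x) * (c * 1)) x :=
        ((hasDerivAt_id x).const_mul c).exp
      refine ((P.hasDerivAt x).add (hexp.mul (Q.hasDerivAt x))).congr_deriv ?_
      simp only [hR, Polynomial.eval_add, Polynomial.eval_mul, Polynomial.eval_C]
      ring
    obtain ⟨T, hT, hST⟩ := exists_finset_zeros_of_hasDerivAt hderiv S hS
    have hTcard := ih P.derivative R hP hR0 T hT
    rw [Polynomial.natDegree_eq_of_degree_eq hdeg] at hTcard
    omega

/-- A quasipolynomial `Δ(s) = sⁿ + Σ_{k<n} aₖ sᵏ + e^{-sτ} Σ_{k≤m} bₖ sᵏ` of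
retarded type (`n > m`) has at most `n + m + 1` distinct real roots. -/
theorem card_real_roots_le_nmp1 (n m : ℕ) (hnm : m < n) (τ : ℝ) (hτ : 0 < τ)
    (a b : ℕ → ℝ) (S : Finset ℝ)
    (hS : ∀ s ∈ S, ((s : ℂ) ^ n + (∑ k ∈ Finset.range n, (a k : ℂ) * (s : ℂ) ^ k)
      + Complex.exp (-(s : ℂ) * τ) * ∑ k ∈ Finset.range (m + 1), (b k : ℂ) * (s : ℂ) ^ k) = 0) :
    S.card ≤ n + m + 1 := by
  set A : Polynomial ℝ := ∑ k ∈ Finset.range n, Polynomial.C (a k) * Polynomial.X ^ k with hA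
  set P : Polynomial ℝ := Polynomial.X ^ n + A with hP
  set Q : Polynomial ℝ :=
    ∑ k ∈ Finset.range (m + 1), Polynomial.C (b k) * Polynomial.X ^ k with hQ
  have hzero : ∀ s ∈ S, P.eval s + Real.exp (-τ * s) * Q.eval s = 0 := by
    intro s hs
    have h := hS s hs
    rw [show -(s : ℂ) * τ = -τ * s by ring] at h
    simp only [hP, hA, hQ, Polynomial.eval_add, Polynomial.eval_pow, Polynomial.eval_X,
      Polynomial.eval_finsetSum, Polynomial.eval_mul, Polynomial.eval_C]
    exact_mod_cast h
  have hAdeg : A.degree < n := by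
    rw [hA, Polynomial.degree_lt_iff_coeff_zero]
    intro k hk
    simp [Polynomial.coeff_C_mul, Polynomial.coeff_X_pow, hk]
  have hmonic : P.Monic := Polynomial.monic_X_pow_add hAdeg
  have hPdeg : P.natDegree = n := by
    refine Polynomial.natDegree_eq_of_degree_eq_some ?_
    rw [hP, Polynomial.degree_add_eq_left_of_degree_lt] <;> simp [hAdeg]
  have hQdeg : Q.natDegree ≤ m :=
    Polynomial.natDegree_sum_le_of_forall_le _ _ fun k hk ↦
      (Polynomial.natDegree_C_mul_X_pow_le _ _).trans (by grind)
  by_cases hQ0 : Q = 0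
  · have hcard : S.card ≤ P.natDegree := by
      refine Polynomial.card_le_degree_of_subset_roots fun s hs ↦ ?_
      simpa [hQ0, hmonic.ne_zero] using hzero s hs
    omega
  · have hcard := card_zeros_add_exp_mul_le (neg_ne_zero.2 hτ.ne') (n + 1) P Q
      (Polynomial.iterate_derivative_eq_zero (by omega)) hQ0 S hzero
    omega
end

section
/- Let τ > 0 and s_0 ∈ ℝ, and set a_0 = −s_0 − 1/τ and b_0 = e^{s_0 τ}/τ, so that s_0 is a root of multiplicity 2 of the quasipolynomial Δ(s) = s + a_0 + b_0 e^{-sτ}. Then s_0 is strictly dominant: every root s ∈ ℂ of Δ with s ≠ s_0 satisfies Re s < s_0. -/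
open Complex

/-- Every nonzero root of `z - 1 + e^{-z}` lies in the open left half-plane. -/
lemma re_neg_of_sub_one_add_exp_neg_eq_zero {z : ℂ} (h : z - 1 + exp (-z) = 0)
    (hz : z ≠ 0) : z.re < 0 := by
  by_contra! hx
  have hre := congrArg Complex.re h
  have him := congrArg Complex.im h
  simp only [add_re, sub_re, one_re, exp_re, neg_re, neg_im, Real.cos_neg, zero_re] at hre
  simp only [add_im, sub_im, one_im, exp_im, neg_re, neg_im, Real.sin_neg, zero_im] at him
  have hy : z.im = 0 := by
    by_contra hy
    have hsin : |Real.sin z.im| < |z.im| := Real.abs_sin_lt_abs hy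
    have hexp : Real.exp (-z.re) ≤ 1 := Real.exp_le_one_iff.mpr (by linarith)
    have habs : |z.im| = Real.exp (-z.re) * |Real.sin z.im| := by
      rw [← Real.abs_exp, ← abs_mul]
      congr 1
      linarith
    nlinarith [abs_nonneg (Real.sin z.im)]
  have hx0 : z.re ≠ 0 := fun h0 => hz (Complex.ext h0 hy)
  have hlt := Real.add_one_lt_exp (neg_ne_zero.mpr hx0)
  rw [hy, Real.cos_zero] at hre
  linarith

/-- MID for `n = 1`, `m = 0`: with `a₀ = -s₀ - 1/τ` and `b₀ = e^{s₀ τ}/τ`, the double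
root `s₀` of `Δ(s) = s + a₀ + b₀ e^{-sτ}` is strictly dominant. -/
theorem double_root_strictly_dominant_first_order (τ : ℝ) (hτ : 0 < τ) (s₀ : ℝ)
    (a₀ b₀ : ℝ) (ha₀ : a₀ = -s₀ - 1 / τ) (hb₀ : b₀ = Real.exp (s₀ * τ) / τ) :
    ∀ s : ℂ, s + (a₀ : ℂ) + (b₀ : ℂ) * Complex.exp (-s * τ) = 0 → s ≠ (s₀ : ℂ) →
      s.re < s₀ := by
  intro s hs hne
  have hτ' : (τ : ℂ) ≠ 0 := ofReal_ne_zero.mpr hτ.ne'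
  have hroot : (s - s₀) * τ - 1 + exp (-((s - s₀) * τ)) = 0 := by
    have hexp : exp (-((s - s₀) * τ)) = exp (s₀ * τ) * exp (-s * τ) := by
      rw [← Complex.exp_add]
      congr 1
      ring
    rw [ha₀, hb₀] at hs
    push_cast at hs
    rw [hexp, neg_mul]
    rw [neg_mul] at hs
    field_simp at hs
    linear_combination hs
  have hneg := re_neg_of_sub_one_add_exp_neg_eq_zero hroot
    (mul_ne_zero (sub_ne_zero.mpr hne) hτ')
  rw [re_mul_ofReal, sub_re, ofReal_re] at hneg
  linarith [neg_of_mul_neg_left hneg hτ.le]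
end

section
/- Let τ > 0, and set b_1 = 2(√2 − 1) e^{−2+√2} / τ, b_0 = 2(5√2 − 7) e^{−2+√2} / τ², and s_0 = −(2 − √2)/τ, so that s_0 is a root of multiplicity 3 of the quasipolynomial Δ(s) = s² + (b_1 s + b_0) e^{-sτ}. Then s_0 is strictly dominant: every root s ∈ ℂ of Δ with s ≠ s_0 satisfies Re s < s_0. In particular, since s_0 < 0, all roots of Δ have negative real part. -/
open Complex

/-- If a density `u ↦ a + p (1 - u)` on `[0, 1]` is positive with total mass one, then its Laplace
transform does not take the value `1` at a nonzero point of the closed right half-plane. -/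
theorem integral_affine_mul_cexp_ne_one {a p : ℝ} (ha : 0 < a) (hp : 0 ≤ p)
    (hmass : a + p / 2 = 1) {z : ℂ} (hz : z ≠ 0) (hre : 0 ≤ z.re) :
    ∫ u in (0 : ℝ)..1, ((a + p * (1 - u) : ℝ) : ℂ) * exp (-z * u) ≠ 1 := by
  intro h
  have hint : IntervalIntegrable (fun u : ℝ ↦ ((a + p * (1 - u) : ℝ) : ℂ) * exp (-z * u))
      MeasureTheory.volume 0 1 := by
    apply Continuous.intervalIntegrable
    fun_prop
  have hreal : ∫ u in (0 : ℝ)..1, (a + p * (1 - u)) * (exp (-z * u)).re = 1 := by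
    have := intervalIntegral.intervalIntegral_re hint
    rw [h] at this
    simpa only [RCLike.re_to_complex, re_ofReal_mul, one_re] using this
  have hone : ∫ u in (0 : ℝ)..1, (a + p * (1 - u)) = 1 := by
    have hF (u : ℝ) : HasDerivAt (fun u : ℝ ↦ (a + p) * u - p / 2 * u ^ 2)
        (a + p * (1 - u)) u := by
      refine (((hasDerivAt_id u).const_mul (a + p)).sub
        (((hasDerivAt_id u).pow 2).const_mul (p / 2))).congr_deriv ?_
      simp only [id]
      norm_num
      ring
    rw [intervalIntegral.integral_eq_sub_of_hasDerivAt (fun u _ ↦ hF u)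
      (Continuous.intervalIntegrable (by fun_prop) _ _)]
    linarith
  have hpos : 0 < ∫ u in (0 : ℝ)..1, (a + p * (1 - u)) * (1 - (exp (-z * u)).re) := by
    have hdens {u : ℝ} (hu : u ≤ 1) : 0 < a + p * (1 - u) :=
      add_pos_of_pos_of_nonneg ha (mul_nonneg hp (by linarith))
    have hexp (u : ℝ) :
        (exp (-z * u)).re = Real.exp (-(z.re * u)) * Real.cos (z.im * u) := by
      simp [exp_re]
    refine intervalIntegral.integral_pos one_pos (by fun_prop) (fun u hu ↦ ?_) ?_
    · refine mul_nonneg (hdens hu.2).le (sub_nonneg.2 ?_)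
      refine (re_le_norm _).trans ?_
      rw [norm_exp, Real.exp_le_one_iff]
      simpa using mul_nonneg hre hu.1.le
    · have hd : 0 < 1 + |z.im| := by positivity
      have hc0 : 0 < (1 + |z.im|)⁻¹ := inv_pos.2 hd
      have hc1 : (1 + |z.im|)⁻¹ ≤ 1 := inv_le_one_of_one_le₀ (by linarith [abs_nonneg z.im])
      refine ⟨_, ⟨hc0.le, hc1⟩, mul_pos (hdens hc1) (sub_pos.2 ?_)⟩
      rcases hre.eq_or_lt with hx | hx
      · have hy : z.im ≠ 0 := fun hy ↦ hz (Complex.ext hx.symm hy)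
        rw [hexp, ← hx, zero_mul, neg_zero, Real.exp_zero, one_mul]
        refine (Real.cos_le_one _).lt_of_ne fun hcos ↦ ?_
        have hlt : |z.im * (1 + |z.im|)⁻¹| < 1 := by
          rw [abs_mul, abs_of_pos hc0, ← div_eq_mul_inv, div_lt_one hd]
          linarith
        have hlt' := abs_lt.1 hlt
        exact mul_ne_zero hy hc0.ne' ((Real.cos_eq_one_iff_of_lt_of_lt
          (by linarith [Real.pi_gt_three]) (by linarith [Real.pi_gt_three])).1 hcos)
      · refine (re_le_norm _).trans_lt ?_
        rw [norm_exp, Real.exp_lt_one_iff, re_mul_ofReal, neg_re, neg_mul]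
        exact neg_neg_of_pos (mul_pos hx hc0)
  have hzero : ∫ u in (0 : ℝ)..1, (a + p * (1 - u)) * (1 - (exp (-z * u)).re) = 0 := by
    simp only [mul_sub (_ + _), mul_one]
    rw [intervalIntegral.integral_sub, hreal]
    · simpa [mul_sub] using sub_eq_zero.2 hone
    · exact Continuous.intervalIntegrable (by fun_prop) _ _
    · exact Continuous.intervalIntegrable (by fun_prop) _ _
  exact hpos.ne' hzero

theorem sq_mul_integral_affine_mul_cexp (a p : ℝ) (z : ℂ) :
    z ^ 2 * ∫ u in (0 : ℝ)..1, ((a + p * (1 - u) : ℝ) : ℂ) * exp (-z * u) =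
      (a + p) * z - p - (a * z - p) * exp (-z) := by
  have hF (u : ℝ) :
      HasDerivAt (fun u : ℝ ↦ -(z * (a + p * (1 - u)) - p) * exp (-z * u))
        (z ^ 2 * (((a + p * (1 - u) : ℝ) : ℂ) * exp (-z * u))) u := by
    have hid : HasDerivAt (fun u : ℝ ↦ (u : ℂ)) 1 u := ofRealCLM.hasDerivAt
    have hlin := (((((hid.const_sub 1).const_mul (p : ℂ)).const_add (a : ℂ)).const_mul z).sub_const
      (p : ℂ)).neg
    refine (hlin.mul (hid.const_mul (-z)).cexp).congr_deriv ?_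
    rw [Pi.neg_apply]
    push_cast
    ring
  rw [← intervalIntegral.integral_const_mul,
    intervalIntegral.integral_eq_sub_of_hasDerivAt (fun u _ ↦ hF u)
      (Continuous.intervalIntegrable (by fun_prop) _ _)]
  simp
  ring

/-- A quasipolynomial with a triple root at the origin has no other root in the closed right
half-plane. -/
theorem quasipolynomial_ne_zero_of_re_nonneg {a p : ℝ} (ha : 0 < a) (hp : 0 ≤ p)
    (hmass : a + p / 2 = 1) {z : ℂ} (hz : z ≠ 0) (hre : 0 ≤ z.re) :
    z ^ 2 - (a + p) * z + p + (a * z - p) * exp (-z) ≠ 0 := by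
  intro h
  refine integral_affine_mul_cexp_ne_one ha hp hmass hz hre
    (mul_left_cancel₀ (pow_ne_zero 2 hz) ?_)
  rw [sq_mul_integral_affine_mul_cexp]
  linear_combination -h

/-- MID for the double integrator: with `b₁ = 2(√2-1)e^{-2+√2}/τ`,
`b₀ = 2(5√2-7)e^{-2+√2}/τ²` and `s₀ = -(2-√2)/τ`, the triple root `s₀` of
`Δ(s) = s² + (b₁ s + b₀) e^{-sτ}` is strictly dominant; in particular all roots
have negative real part. -/
theorem triple_root_strictly_dominant_double_integrator (τ : ℝ) (hτ : 0 < τ)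
    (b₀ b₁ s₀ : ℝ)
    (hb₁ : b₁ = 2 * (Real.sqrt 2 - 1) * Real.exp (-2 + Real.sqrt 2) / τ)
    (hb₀ : b₀ = 2 * (5 * Real.sqrt 2 - 7) * Real.exp (-2 + Real.sqrt 2) / τ ^ 2)
    (hs₀ : s₀ = -(2 - Real.sqrt 2) / τ) :
    (∀ s : ℂ, s ^ 2 + ((b₁ : ℂ) * s + (b₀ : ℂ)) * Complex.exp (-s * τ) = 0 →
      s ≠ (s₀ : ℂ) → s.re < s₀) ∧
    (∀ s : ℂ, s ^ 2 + ((b₁ : ℂ) * s + (b₀ : ℂ)) * Complex.exp (-s * τ) = 0 →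
      s.re < 0) := by
  have hsq : Real.sqrt 2 ^ 2 = 2 := Real.sq_sqrt zero_le_two
  have hgt : 1 < Real.sqrt 2 := Real.lt_sqrt_of_sq_lt (by norm_num)
  have hlt : Real.sqrt 2 < 2 := by nlinarith
  have hneg : s₀ < 0 := by
    rw [hs₀]
    exact div_neg_of_neg_of_pos (by linarith) hτ
  have hdom : ∀ s : ℂ, s ^ 2 + ((b₁ : ℂ) * s + (b₀ : ℂ)) * Complex.exp (-s * τ) = 0 →
      s ≠ (s₀ : ℂ) → s.re < s₀ := by
    intro s hs hne
    by_contra! hre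
    have hτ' : (τ : ℂ) ≠ 0 := ofReal_ne_zero.2 hτ.ne'
    have hz : (s - s₀) * τ ≠ 0 := mul_ne_zero (sub_ne_zero.2 hne) hτ'
    have hzre : 0 ≤ ((s - s₀) * τ).re := by
      simpa using mul_nonneg (sub_nonneg.2 hre) hτ.le
    refine quasipolynomial_ne_zero_of_re_nonneg (a := 2 * (Real.sqrt 2 - 1))
      (p := (2 - Real.sqrt 2) ^ 2) (by linarith) (sq_nonneg _) (by linarith) hz hzre ?_
    have hsqC : (Real.sqrt 2 : ℂ) ^ 2 = 2 := by exact_mod_cast hsq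
    have hs₀τ : (s₀ : ℂ) * τ = Real.sqrt 2 - 2 := by
      rw [hs₀]
      push_cast
      field_simp
      ring
    have hb₁τ : (b₁ : ℂ) * τ = 2 * (Real.sqrt 2 - 1) * exp (-2 + Real.sqrt 2) := by
      rw [hb₁]
      push_cast
      field_simp
    have hb₀τ : (b₀ : ℂ) * τ ^ 2 = 2 * (5 * Real.sqrt 2 - 7) * exp (-2 + Real.sqrt 2) := by
      rw [hb₀]
      push_cast
      field_simp
    have hexp : exp (-((s - s₀) * τ)) = exp (-2 + Real.sqrt 2) * exp (-s * τ) := by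
      rw [← exp_add]
      congr 1
      linear_combination hs₀τ
    have hz' : (s - s₀) * τ = s * τ - (Real.sqrt 2 - 2) := by linear_combination -hs₀τ
    rw [hexp, hz']
    push_cast
    generalize exp (-s * τ) = E at *
    generalize exp (-2 + (Real.sqrt 2 : ℂ)) = K at *
    generalize (Real.sqrt 2 : ℂ) = w at *
    linear_combination (τ : ℂ) ^ 2 * hs - s * τ * E * hb₁τ - E * hb₀τ + (-(s * τ + 2 - w) - 3 * E * K) * hsqC
  refine ⟨hdom, fun s hs ↦ ?_⟩
  rcases eq_or_ne s s₀ with rfl | hne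
  · simpa using hneg
  · exact (hdom s hs hne).trans hneg
end

section
/- Let n and m be nonnegative integers with n > m, let τ > 0, and let s_0 ∈ ℝ. Then there exists a unique tuple of real coefficients (a_0, …, a_{n-1}, b_0, …, b_m) such that s_0 is a root of multiplicity at least n + m + 1 of the quasipolynomial Δ(s) = s^n + Σ_{k=0}^{n-1} a_k s^k + e^{-sτ} Σ_{k=0}^{m} b_k s^k, i.e., such that Δ^{(k)}(s_0) = 0 for all k = 0, 1, …, n + m. -/
open Complex Finset

open Polynomial in
/-- The operator `D - τ` on polynomials, where `D` is differentiation: the derivative of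
`e^{-τ s} Q(s)` is `e^{-τ s} ((D - τ) Q)(s)`. -/
noncomputable def twistedDerivative (τ : ℝ) : ℝ[X] →ₗ[ℝ] ℝ[X] :=
  derivative - τ • LinearMap.id

namespace twistedDerivative

open Polynomial

theorem apply (τ : ℝ) (Q : ℝ[X]) :
    twistedDerivative τ Q = derivative Q - τ • Q := rfl

theorem injective {τ : ℝ} (hτ : τ ≠ 0) : Function.Injective (twistedDerivative τ) := by
  rw [← LinearMap.ker_eq_bot, LinearMap.ker_eq_bot']
  intro Q hQ
  by_contra hne
  have h := degree_derivative_lt hne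
  rw [apply, sub_eq_zero] at hQ
  rw [hQ, degree_smul_of_smul_regular _ (IsSMulRegular.of_ne_zero hτ)] at h
  exact lt_irrefl _ h

theorem pow_mem_degreeLT (τ : ℝ) {N : ℕ} {Q : ℝ[X]} (hQ : Q ∈ degreeLT ℝ N) (k : ℕ) :
    (twistedDerivative τ ^ k) Q ∈ degreeLT ℝ N := by
  induction k with
  | zero => simpa using hQ
  | succ k ih =>
    rw [pow_succ', Module.End.mul_apply, apply]
    refine sub_mem ?_ (Submodule.smul_mem _ _ ih)
    rw [mem_degreeLT] at ih ⊢
    exact degree_derivative_le.trans_lt ih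

theorem eval_iterate_derivative_eq_zero (τ x : ℝ) (j : ℕ) (R : ℝ[X])
    (h : ∀ i ≤ j, eval x ((twistedDerivative τ ^ i) R) = 0) :
    eval x (derivative^[j] R) = 0 := by
  induction j generalizing R with
  | zero => simpa using h 0 le_rfl
  | succ j ih =>
    have hD : derivative R = twistedDerivative τ R + τ • R := by simp [apply]
    rw [Function.iterate_succ_apply, hD, iterate_map_add, iterate_derivative_smul,
      eval_add, eval_smul, ih R fun i hi ↦ h i (by omega), ih (twistedDerivative τ R), smul_zero,
      add_zero]
    intro i hi
    rw [← Module.End.mul_apply, ← pow_succ]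
    exact h (i + 1) (by omega)

end twistedDerivative

open Polynomial in
theorem Polynomial.eq_zero_of_eval_iterate_derivative_eq_zero_s6 {N : ℕ} {R : ℝ[X]} {x : ℝ}
    (hR : R ∈ degreeLT ℝ N) (h : ∀ j < N, eval x (derivative^[j] R) = 0) : R = 0 := by
  by_contra hne
  rw [mem_degreeLT, degree_eq_natDegree hne, Nat.cast_lt] at hR
  have hle : R.rootMultiplicity x ≤ R.natDegree := by
    classical
    rw [← count_roots]
    exact (Multiset.count_le_card x _).trans (card_roots' R)
  exact hle.not_gt <|
    (lt_rootMultiplicity_iff_isRoot_iterate_derivative hne).2 fun j hj ↦ h j (by omega)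

open Polynomial in
/-- A quasipolynomial `P(s) + e^{-τ s} Q(s)` with `deg P < n` and `deg Q < M` that has a zero of
multiplicity `n + M` vanishes; here `c = e^{-τ x}`. -/
theorem eq_zero_of_quasipolynomial_derivatives_eq_zero {τ c x : ℝ} (hτ : τ ≠ 0) (hc : c ≠ 0)
    {n M : ℕ} {P Q : ℝ[X]} (hP : P ∈ degreeLT ℝ n) (hQ : Q ∈ degreeLT ℝ M)
    (h : ∀ k < n + M,
      eval x (derivative^[k] P) + c * eval x ((twistedDerivative τ ^ k) Q) = 0) :
    P = 0 ∧ Q = 0 := by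
  have hQ0 : Q = 0 := by
    have hR : (twistedDerivative τ ^ n) Q = 0 := by
      refine eq_zero_of_eval_iterate_derivative_eq_zero_s6 (x := x)
        (twistedDerivative.pow_mem_degreeLT τ hQ n) fun j hj ↦
        twistedDerivative.eval_iterate_derivative_eq_zero τ x j _ fun i hi ↦ ?_
      have hk := h (i + n) (by omega)
      have hPk : derivative^[i + n] P = 0 := by
        by_cases hP0 : P = 0
        · simp [hP0]
        · rw [mem_degreeLT, degree_eq_natDegree hP0, Nat.cast_lt] at hP
          exact iterate_derivative_eq_zero (by omega)
      rw [hPk, eval_zero, zero_add, pow_add, Module.End.mul_apply] at hk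
      exact (mul_eq_zero.1 hk).resolve_left hc
    have hinj := (twistedDerivative.injective hτ).iterate n
    rw [← Module.End.coe_pow] at hinj
    exact hinj (by rw [hR, map_zero])
  refine ⟨eq_zero_of_eval_iterate_derivative_eq_zero_s6 (x := x) hP fun j hj ↦ ?_, hQ0⟩
  simpa [hQ0] using h j (by omega)

open Polynomial in
theorem iteratedDeriv_quasipolynomial (τ : ℝ) (P Q : ℝ[X]) (k : ℕ) :
    iteratedDeriv k (fun s : ℂ ↦ aeval s P + Complex.exp (-s * τ) * aeval s Q) =
      fun s : ℂ ↦ aeval s (derivative^[k] P) +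
        Complex.exp (-s * τ) * aeval s ((twistedDerivative τ ^ k) Q) := by
  induction k with
  | zero => simp
  | succ k ih =>
    rw [iteratedDeriv_succ, ih]
    funext s
    have hexp : HasDerivAt (fun s : ℂ ↦ Complex.exp (-s * τ))
        (Complex.exp (-s * τ) * (-1 * τ)) s :=
      ((hasDerivAt_id s).neg.mul_const (τ : ℂ)).cexp
    refine (((derivative^[k] P).hasDerivAt_aeval s).add
      (hexp.mul (((twistedDerivative τ ^ k) Q).hasDerivAt_aeval s))).deriv.trans ?_
    rw [Function.iterate_succ_apply', pow_succ', Module.End.mul_apply, twistedDerivative.apply,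
      map_sub, map_smul, Complex.real_smul]
    ring

open Polynomial in
/-- The polynomial `∑ aⱼ Xʲ` of degree less than `N` with prescribed coefficients. -/
noncomputable def polynomialOfCoeffs (N : ℕ) : (Fin N → ℝ) →ₗ[ℝ] ℝ[X] :=
  (degreeLT ℝ N).subtype ∘ₗ (degreeLTEquiv ℝ N).symm.toLinearMap

namespace polynomialOfCoeffs

open Polynomial

theorem mem_degreeLT {N : ℕ} (a : Fin N → ℝ) : polynomialOfCoeffs N a ∈ degreeLT ℝ N :=
  ((degreeLTEquiv ℝ N).symm a).2

theorem injective (N : ℕ) : Function.Injective (polynomialOfCoeffs N) :=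
  Subtype.val_injective.comp (degreeLTEquiv ℝ N).symm.injective

theorem aeval_eq {N : ℕ} (a : Fin N → ℝ) (s : ℂ) :
    aeval s (polynomialOfCoeffs N a) = ∑ j : Fin N, (a j : ℂ) * s ^ (j : ℕ) := by
  have h : polynomialOfCoeffs N a = ∑ j : Fin N, monomial (j : ℕ) (a j) := rfl
  simp [h, aeval_monomial]

end polynomialOfCoeffs

open Polynomial in
/-- The first `K` derivatives at `x` of `P(s) + e^{-τ s} Q(s)`, as a linear function of the
coefficients of `P` and `Q`. -/
noncomputable def quasipolynomialJet (τ x : ℝ) (n M K : ℕ) :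
    (Fin n → ℝ) × (Fin M → ℝ) →ₗ[ℝ] Fin K → ℝ :=
  LinearMap.pi fun k ↦ leval x ∘ₗ
    LinearMap.coprod ((derivative ^ (k : ℕ)) ∘ₗ polynomialOfCoeffs n)
      (Real.exp (-x * τ) • ((twistedDerivative τ ^ (k : ℕ)) ∘ₗ polynomialOfCoeffs M))

namespace quasipolynomialJet

open Polynomial

theorem apply (τ x : ℝ) (n M K : ℕ) (ab : (Fin n → ℝ) × (Fin M → ℝ)) (k : Fin K) :
    quasipolynomialJet τ x n M K ab k =
      eval x (derivative^[k] (polynomialOfCoeffs n ab.1)) +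
        Real.exp (-x * τ) *
          eval x ((twistedDerivative τ ^ (k : ℕ)) (polynomialOfCoeffs M ab.2)) := by
  simp [quasipolynomialJet, leval, Module.End.coe_pow]

theorem bijective {τ : ℝ} (hτ : τ ≠ 0) (x : ℝ) (n M : ℕ) :
    Function.Bijective (quasipolynomialJet τ x n M (n + M)) := by
  have hinj : Function.Injective (quasipolynomialJet τ x n M (n + M)) := by
    rw [← LinearMap.ker_eq_bot, LinearMap.ker_eq_bot']
    intro ab hab
    obtain ⟨h₁, h₂⟩ := eq_zero_of_quasipolynomial_derivatives_eq_zero (x := x) hτ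
      (Real.exp_ne_zero (-x * τ)) (polynomialOfCoeffs.mem_degreeLT ab.1)
      (polynomialOfCoeffs.mem_degreeLT ab.2) fun k hk ↦ by
        simpa only [apply, Pi.zero_apply] using congrFun hab ⟨k, hk⟩
    exact Prod.ext (polynomialOfCoeffs.injective n (h₁.trans (map_zero _).symm))
      (polynomialOfCoeffs.injective M (h₂.trans (map_zero _).symm))
  exact ⟨hinj, (LinearMap.injective_iff_surjective_of_finrank_eq_finrank (by simp)).1 hinj⟩

end quasipolynomialJet

open Polynomial in
theorem iteratedDeriv_monic_quasipolynomial (τ x : ℝ) {n M K : ℕ}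
    (ab : (Fin n → ℝ) × (Fin M → ℝ)) (k : Fin K) :
    iteratedDeriv k
      (fun s : ℂ => s ^ n + (∑ j : Fin n, (ab.1 j : ℂ) * s ^ (j : ℕ))
        + Complex.exp (-s * τ) * ∑ j : Fin M, (ab.2 j : ℂ) * s ^ (j : ℕ)) (x : ℂ) =
      ((eval x (derivative^[k] (X ^ n : ℝ[X])) + quasipolynomialJet τ x n M K ab k : ℝ) : ℂ) := by
  have haeval (P : ℝ[X]) : aeval (x : ℂ) P = ((eval x P : ℝ) : ℂ) :=
    aeval_algebraMap_apply_eq_algebraMap_eval x P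
  have hfun : (fun s : ℂ => s ^ n + (∑ j : Fin n, (ab.1 j : ℂ) * s ^ (j : ℕ))
        + Complex.exp (-s * τ) * ∑ j : Fin M, (ab.2 j : ℂ) * s ^ (j : ℕ)) =
      fun s : ℂ ↦ aeval s (X ^ n + polynomialOfCoeffs n ab.1) +
        Complex.exp (-s * τ) * aeval s (polynomialOfCoeffs M ab.2) := by
    funext s
    simp only [map_add, map_pow, aeval_X, polynomialOfCoeffs.aeval_eq]
  rw [hfun, iteratedDeriv_quasipolynomial]
  simp only [haeval, quasipolynomialJet.apply, iterate_map_add, eval_add]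
  push_cast
  ring

/-- Classic MID assignment: for any `n > m`, `τ > 0` and real `s₀`, there is a unique
tuple of coefficients `(a₀,…,a_{n-1}, b₀,…,b_m)` making `s₀` a root of multiplicity at
least `n + m + 1` of `Δ(s) = sⁿ + Σ_{k<n} aₖ sᵏ + e^{-sτ} Σ_{k≤m} bₖ sᵏ`. -/
theorem existsUnique_coeffs_max_multiplicity (n m : ℕ) (hnm : m < n) (τ : ℝ) (hτ : 0 < τ)
    (s₀ : ℝ) :
    ∃! ab : (Fin n → ℝ) × (Fin (m + 1) → ℝ),
      ∀ k : ℕ, k ≤ n + m →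
        iteratedDeriv k
          (fun s : ℂ => s ^ n + (∑ j : Fin n, (ab.1 j : ℂ) * s ^ (j : ℕ))
            + Complex.exp (-s * τ) * ∑ j : Fin (m + 1), (ab.2 j : ℂ) * s ^ (j : ℕ))
          (s₀ : ℂ) = 0 := by
  have hiff (ab : (Fin n → ℝ) × (Fin (m + 1) → ℝ)) :
      (∀ k : ℕ, k ≤ n + m →
        iteratedDeriv k
          (fun s : ℂ => s ^ n + (∑ j : Fin n, (ab.1 j : ℂ) * s ^ (j : ℕ))
            + Complex.exp (-s * τ) * ∑ j : Fin (m + 1), (ab.2 j : ℂ) * s ^ (j : ℕ))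
          (s₀ : ℂ) = 0) ↔
      quasipolynomialJet τ s₀ n (m + 1) (n + (m + 1)) ab = fun k : Fin _ ↦
        -Polynomial.eval s₀ (Polynomial.derivative^[k] (Polynomial.X ^ n : Polynomial ℝ)) := by
    have hk (k : Fin (n + (m + 1))) := iteratedDeriv_monic_quasipolynomial τ s₀ ab k
    refine ⟨fun h ↦ funext fun k ↦ ?_, fun h k hkm ↦ ?_⟩
    · rw [eq_neg_iff_add_eq_zero, add_comm, ← Complex.ofReal_eq_zero, ← hk]
      exact h k (by omega)
    · rw [hk ⟨k, by omega⟩, h, add_neg_cancel, Complex.ofReal_zero]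
  simp only [hiff]
  exact (quasipolynomialJet.bijective hτ.ne' s₀ n (m + 1)).existsUnique _
end

section
/- Let n be a positive integer, m = n − 1, τ > 0, and let a_0, …, a_{n-1}, b_0, …, b_{n-1} be real numbers. Consider the quasipolynomial Δ(s) = s^n + Σ_{k=0}^{n-1} a_k s^k + e^{-sτ} Σ_{k=0}^{n-1} b_k s^k. If a real number s_0 is a root of Δ of multiplicity n + m + 1 = 2n (i.e., Δ^{(k)}(s_0) = 0 for k = 0, …, 2n − 1), then s_0 is strictly dominant: every root s ∈ ℂ of Δ with s ≠ s_0 satisfies Re s < s_0. -/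
open Complex Finset

open Polynomial Filter Topology

/-- The order of vanishing drops by at most one under differentiation. -/
lemma natCast_le_analyticOrderAt_deriv {f : ℂ → ℂ} {z : ℂ} {m : ℕ} (hf : AnalyticAt ℂ f z)
    (h : ((m + 1 : ℕ) : ℕ∞) ≤ analyticOrderAt f z) : (m : ℕ∞) ≤ analyticOrderAt (deriv f) z := by
  rw [natCast_le_analyticOrderAt_iff_iteratedDeriv_eq_zero hf] at h
  rw [natCast_le_analyticOrderAt_iff_iteratedDeriv_eq_zero hf.deriv]
  intro i hi
  rw [← iteratedDeriv_succ']
  exact h (i + 1) (by lia)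

/-- The quasipolynomial `P(z) + e^{-z} Q(z)`. -/
noncomputable def expPoly (P Q : ℂ[X]) (z : ℂ) : ℂ := P.eval z + exp (-z) * Q.eval z

lemma hasDerivAt_expPoly (P Q : ℂ[X]) (z : ℂ) :
    HasDerivAt (expPoly P Q) (expPoly (derivative P) (derivative Q - Q) z) z := by
  refine HasDerivAt.congr_deriv
    ((P.hasDerivAt z).add ((hasDerivAt_id z).neg.cexp.mul (Q.hasDerivAt z))) ?_
  simp [expPoly]
  ring

lemma deriv_expPoly (P Q : ℂ[X]) :
    deriv (expPoly P Q) = expPoly (derivative P) (derivative Q - Q) :=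
  funext fun z => (hasDerivAt_expPoly P Q z).deriv

lemma differentiable_expPoly (P Q : ℂ[X]) : Differentiable ℂ (expPoly P Q) :=
  fun z => (hasDerivAt_expPoly P Q z).differentiableAt

lemma analyticAt_expPoly (P Q : ℂ[X]) (z : ℂ) : AnalyticAt ℂ (expPoly P Q) z :=
  (differentiable_expPoly P Q).analyticAt z

lemma Polynomial.eq_zero_of_natCast_le_analyticOrderAt {Q : ℂ[X]} {q : ℕ}
    (hQ : ∀ k, q ≤ k → Q.coeff k = 0)
    (h : (q : ℕ∞) ≤ analyticOrderAt (fun z => Q.eval z) 0) : Q = 0 := by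
  induction q generalizing Q with
  | zero => ext k; simpa using hQ k (Nat.zero_le k)
  | succ q ih =>
    have hd : derivative Q = 0 := by
      refine ih (fun k hk => by simp [coeff_derivative, hQ (k + 1) (by lia)]) ?_
      have := natCast_le_analyticOrderAt_deriv (Q.differentiable.analyticAt 0) h
      have hderiv : _root_.deriv (fun z => Q.eval z) = fun z => (derivative Q).eval z := by
        funext z
        exact Q.deriv
      rwa [hderiv] at this
    have h0 : Q.eval 0 = 0 :=
      apply_eq_zero_of_analyticOrderAt_ne_zero (f := fun z => Q.eval z)
        (by rintro h'; rw [h'] at h; simp at h)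
    rw [eq_C_of_derivative_eq_zero hd] at h0 ⊢
    simpa using h0

/-- A nontrivial quasipolynomial with `p + q` coefficients vanishes to order less than `p + q`. -/
lemma expPoly_eq_zero {p q : ℕ} {P Q : ℂ[X]} (hP : ∀ k, p ≤ k → P.coeff k = 0)
    (hQ : ∀ k, q ≤ k → Q.coeff k = 0)
    (h : ((p + q : ℕ) : ℕ∞) ≤ analyticOrderAt (expPoly P Q) 0) : P = 0 ∧ Q = 0 := by
  induction p generalizing P Q with
  | zero =>
    have hP0 : P = 0 := by ext k; simpa using hP k (Nat.zero_le k)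
    refine ⟨hP0, Q.eq_zero_of_natCast_le_analyticOrderAt hQ ?_⟩
    have he : AnalyticAt ℂ (fun z : ℂ => exp (-z)) 0 := by fun_prop
    have hfac : expPoly P Q = (fun z : ℂ => exp (-z)) * fun z => Q.eval z := by
      funext z; simp [expPoly, hP0]
    rw [hfac, analyticOrderAt_mul he (Q.differentiable.analyticAt 0),
      he.analyticOrderAt_eq_zero.2 (exp_ne_zero _)] at h
    simpa using h
  | succ p ih =>
    have hd := natCast_le_analyticOrderAt_deriv (m := p + q) (analyticAt_expPoly P Q 0)
      (by rwa [add_right_comm])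
    rw [deriv_expPoly] at hd
    obtain ⟨hP', hQ'⟩ := ih (fun k hk => by simp [coeff_derivative, hP (k + 1) (by lia)])
      (fun k hk => by simp [coeff_derivative, hQ k hk, hQ (k + 1) (by lia)]) hd
    have hQ0 : Q = 0 := by
      by_contra hne
      have := degree_derivative_lt hne
      rw [sub_eq_zero.1 hQ'] at this
      exact lt_irrefl _ this
    have h0 : expPoly P Q 0 = 0 :=
      apply_eq_zero_of_analyticOrderAt_ne_zero (by
        intro h'; rw [h'] at h; simp at h)
    refine ⟨?_, hQ0⟩
    rw [eq_C_of_derivative_eq_zero hP'] at h0 ⊢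
    simpa [expPoly, hQ0] using h0

/-- A quasipolynomial of maximal multiplicity `2n` at the origin satisfies a Kummer equation. -/
lemma expPoly_kummer {n : ℕ} (hn : 0 < n) {P Q : ℂ[X]} (hP : ∀ k, n + 1 ≤ k → P.coeff k = 0)
    (hQ : ∀ k, n ≤ k → Q.coeff k = 0)
    (h : ((2 * n : ℕ) : ℕ∞) ≤ analyticOrderAt (expPoly P Q) 0) (z : ℂ) :
    z * deriv (deriv (expPoly P Q)) z + (z + 1 - 2 * n) * deriv (expPoly P Q) z
      - n * expPoly P Q z = 0 := by
  obtain ⟨m, rfl⟩ : ∃ m, n = m + 1 := ⟨n - 1, by lia⟩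
  set D := expPoly P Q with hD
  set c : ℂ := ((m + 1 : ℕ) : ℂ)
  let P₂ : ℂ[X] := X * derivative (derivative P) + X * derivative P
    + C (1 - 2 * c) * derivative P - C c * P
  let Q₂ : ℂ[X] := X * derivative (derivative Q) - X * derivative Q
    + C (1 - 2 * c) * derivative Q + C (c - 1) * Q
  have hfun : expPoly P₂ Q₂ = (id * deriv (deriv D)) + (fun z => z + 1 - 2 * c) * deriv D
      - (fun _ => c) * D := by
    funext w
    simp only [hD, deriv_expPoly, expPoly, P₂, Q₂, Pi.add_apply, Pi.sub_apply, Pi.mul_apply,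
      eval_add, eval_sub, eval_mul, eval_X, eval_C, derivative_sub, id]
    ring
  have hDan : AnalyticAt ℂ D 0 := analyticAt_expPoly P Q 0
  have h1 : ((2 * m + 1 : ℕ) : ℕ∞) ≤ analyticOrderAt (deriv D) 0 :=
    natCast_le_analyticOrderAt_deriv hDan h
  have h2 : ((2 * m : ℕ) : ℕ∞) ≤ analyticOrderAt (deriv (deriv D)) 0 :=
    natCast_le_analyticOrderAt_deriv hDan.deriv h1
  have hord : ((m + 1 + m : ℕ) : ℕ∞) ≤ analyticOrderAt (expPoly P₂ Q₂) 0 := by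
    rw [show m + 1 + m = 2 * m + 1 by ring, hfun]
    refine le_trans (le_min (le_trans (le_min ?_ ?_) le_analyticOrderAt_add) ?_)
      le_analyticOrderAt_sub
    · rw [analyticOrderAt_mul analyticAt_id hDan.deriv.deriv, analyticOrderAt_id]
      push_cast at h2 ⊢
      rw [add_comm]
      gcongr
    · rw [analyticOrderAt_mul (by fun_prop) hDan.deriv]
      exact h1.trans le_add_self
    · rw [analyticOrderAt_mul (by fun_prop) hDan]
      exact le_trans (by exact_mod_cast (by lia)) (h.trans le_add_self)
  have hcoeffP : ∀ k, m + 1 ≤ k → P₂.coeff k = 0 := by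
    rintro (_ | k) hk
    · lia
    simp only [P₂, coeff_sub, coeff_add, coeff_X_mul, coeff_C_mul, coeff_derivative,
      hP (k + 1 + 1) (by lia)]
    rcases hk.eq_or_lt with hk | hk
    · obtain rfl : m = k := by lia
      simp only [c]; push_cast; ring
    · simp [hP (k + 1) (by lia)]
  have hcoeffQ : ∀ k, m ≤ k → Q₂.coeff k = 0 := by
    rintro k hk
    have hX : ∀ R : ℂ[X], (X * derivative R).coeff k = k * R.coeff k := by
      intro R
      cases k <;> simp [coeff_derivative, mul_comm]
    simp only [Q₂, coeff_sub, coeff_add, hX, coeff_C_mul, coeff_derivative,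
      hQ (k + 1) (by lia)]
    rcases hk.eq_or_lt with rfl | hk
    · simp only [c]; push_cast; ring
    · simp [hQ k (by lia)]
  obtain ⟨hP0, hQ0⟩ := expPoly_eq_zero hcoeffP hcoeffQ hord
  have := congrFun hfun z
  rw [hP0, hQ0] at this
  simpa [expPoly] using this.symm

/-- A nonzero entire solution of `w K'' = (N - 1) K' + (w / 4 + 1 / 2) K` vanishing to order `N` at
the origin has no other zero in the closed right half-plane. -/
lemma eq_zero_of_whittaker {K : ℂ → ℂ} (hK : Differentiable ℂ K) {N : ℕ} (hN : 0 < N)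
    (hode : ∀ w, w * deriv (deriv K) w = (N - 1) * deriv K w + (w / 4 + 1 / 2) * K w)
    (hord : (N : ℕ∞) ≤ analyticOrderAt K 0) {z : ℂ} (hz : z ≠ 0) (hre : 0 ≤ z.re)
    (hKz : K z = 0) : K = 0 := by
  have hKd : ∀ w, HasDerivAt K (deriv K w) w := fun w => (hK w).hasDerivAt
  have hKdd : ∀ w, HasDerivAt (deriv K) (deriv (deriv K) w) w :=
    fun w => (hK.analyticAt w).deriv.differentiableAt.hasDerivAt
  let V : ℂ → ℂ := fun w => w * deriv K w - N * K w
  have hV : ∀ w, HasDerivAt V ((w / 4 + 1 / 2) * K w) w := by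
    intro w
    refine HasDerivAt.congr_deriv
      (((hasDerivAt_id w).mul (hKdd w)).sub ((hKd w).const_mul (N : ℂ))) ?_
    simp only [id]
    linear_combination hode w
  have hline : ∀ t : ℝ, HasDerivAt (fun t : ℝ => z * (t : ℂ)) z t := fun t => by
    simpa using (hasDerivAt_id (t : ℂ)).comp_ofReal.const_mul z
  let Φ : ℝ → ℝ := fun t => (star z * V (z * t) * star (K (z * t))).re / t ^ N
  let Ψ : ℝ → ℝ := fun t => (normSq z * (z.re * t / 4 + 1 / 2) * normSq (K (z * t))
    + z.re * normSq (V (z * t)) / t) / t ^ N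
  have hΦ : ∀ t : ℝ, 0 < t → HasDerivAt Φ (Ψ t) t := by
    intro t ht
    have hVt := (hV (z * t)).comp t (hline t)
    have hKt := ((hKd (z * t)).comp t (hline t)).star
    have hW := reCLM.hasFDerivAt.comp_hasDerivAt t ((hVt.const_mul (star z)).mul hKt)
    refine HasDerivAt.congr_deriv (hW.div (hasDerivAt_pow N t) (pow_ne_zero N ht.ne')) ?_
    obtain ⟨m, rfl⟩ : ∃ m, N = m + 1 := ⟨N - 1, by lia⟩
    have hVe : V (z * t) = z * t * deriv K (z * t) - (m + 1 : ℕ) * K (z * t) := rfl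
    have hd : z * deriv K (z * t) = (V (z * t) + (m + 1 : ℕ) * K (z * t)) / t := by
      rw [hVe]
      have : (t : ℂ) ≠ 0 := by exact_mod_cast ht.ne'
      field_simp
      ring
    simp only [Function.comp_apply, mul_comm (deriv K (z * t)) z, hd, Ψ, reCLM_apply,
      add_tsub_cancel_right, Pi.mul_apply]
    generalize V (z * t) = v
    generalize K (z * t) = k
    simp only [Complex.star_def, mul_re, mul_im, add_re, add_im, conj_re, conj_im, normSq_apply,
      div_ofReal_re, div_ofReal_im, natCast_re, natCast_im, map_div₀,
      conj_ofReal]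
    have e1 : (z * (t : ℂ) / 4).re = z.re * t / 4 := by simp
    have e2 : (z * (t : ℂ) / 4).im = z.im * t / 4 := by simp
    have e3 : (1 / 2 : ℂ).re = 1 / 2 := by simp
    have e4 : (1 / 2 : ℂ).im = 0 := by simp
    rw [e1, e2, e3, e4]
    field_simp
    push_cast
    ring
  have hΨ : ∀ t : ℝ, 0 < t → 0 ≤ Ψ t := by
    intro t ht
    have := normSq_nonneg z
    have := normSq_nonneg (K (z * t))
    have := normSq_nonneg (V (z * t))
    positivity
  have hmono : MonotoneOn Φ (Set.Ioi 0) := by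
    refine monotoneOn_of_deriv_nonneg (convex_Ioi 0)
      (fun t ht => (hΦ t ht).continuousAt.continuousWithinAt) ?_ ?_ <;> rw [interior_Ioi]
    · exact fun t ht => (hΦ t ht).differentiableAt.differentiableWithinAt
    · intro t ht
      rw [(hΦ t ht).deriv]
      exact hΨ t ht
  have hline0 : Tendsto (fun t : ℝ => z * (t : ℂ)) (𝓝[>] 0) (𝓝 0) := by
    have := (hline 0).continuousAt.tendsto
    simp only [ofReal_zero, mul_zero] at this
    exact this.mono_left nhdsWithin_le_nhds
  obtain ⟨g, hg, hKg⟩ := (natCast_le_analyticOrderAt (hK.analyticAt 0)).1 hord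
  have hlim : Tendsto Φ (𝓝[>] 0) (𝓝 0) := by
    have hK0 : K 0 = 0 := apply_eq_zero_of_analyticOrderAt_ne_zero
      (by rintro h'; rw [h'] at hord; simp at hord; lia)
    have hV0 : V 0 = 0 := by simp [V, hK0]
    have hVlim := (hV 0).continuousAt.tendsto.comp hline0
    have hglim := hg.continuousAt.tendsto.comp hline0
    rw [hV0] at hVlim
    have h := continuous_re.continuousAt.tendsto.comp
      (((tendsto_const_nhds (x := star z)).mul hVlim).mul
        ((continuous_star.continuousAt.tendsto.comp hglim).mul
          (tendsto_const_nhds (x := star z ^ N))))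
    simp only [mul_zero, zero_mul, zero_re] at h
    refine h.congr' ?_
    filter_upwards [hline0.eventually hKg, self_mem_nhdsWithin] with t hKt ht
    have ht' : t ^ N ≠ 0 := pow_ne_zero _ (ne_of_gt ht)
    simp only [Φ, Function.comp_apply, hKt, sub_zero, smul_eq_mul]
    rw [eq_div_iff ht', ← re_mul_ofReal]
    congr 1
    simp only [star_mul', star_pow, Complex.star_def, conj_ofReal, mul_pow, ofReal_pow]
    ring
  have hΦ0 : ∀ t ∈ Set.Ioo (0 : ℝ) 1, Φ t = 0 := by
    intro t ht
    refine le_antisymm ?_ ?_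
    · have := hmono ht.1 (Set.mem_Ioi.2 one_pos) ht.2.le
      simpa [Φ, hKz] using this
    · refine le_of_tendsto hlim ?_
      filter_upwards [Ioo_mem_nhdsGT ht.1] with u hu
      exact hmono hu.1 ht.1 hu.2.le
  have hzero : ∀ t ∈ Set.Ioo (0 : ℝ) 1, K (z * t) = 0 := by
    intro t ht
    have hΨ0 : Ψ t = 0 := by
      refine (hΦ t ht.1).unique ((hasDerivAt_const t (0 : ℝ)).congr_of_eventuallyEq ?_)
      filter_upwards [isOpen_Ioo.mem_nhds ht] with u hu using hΦ0 u hu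
    have ht0 : 0 < t := ht.1
    have hnum := (div_eq_zero_iff.1 hΨ0).resolve_right (pow_ne_zero _ ht0.ne')
    have hzpos := normSq_pos.2 hz
    have h1 := normSq_nonneg (K (z * t))
    have h2 : 0 ≤ z.re * normSq (V (z * t)) / t := by
      have := normSq_nonneg (V (z * t))
      positivity
    have h3 : 0 < normSq z * (z.re * t / 4 + 1 / 2) := by positivity
    have h4 := mul_nonneg h3.le h1
    exact normSq_eq_zero.1 ((mul_eq_zero.1 (by linarith)).resolve_left h3.ne')
  rw [← AnalyticOnNhd.analyticOrderAt_eq_top_iff_eq_zero 0 fun w => hK.analyticAt w, analyticOrderAt_eq_top,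
    ← (hK.analyticAt 0).frequently_zero_iff_eventually_zero]
  have hne : Tendsto (fun t : ℝ => z * (t : ℂ)) (𝓝[>] 0) (𝓝[≠] 0) := by
    refine tendsto_nhdsWithin_iff.2 ⟨hline0, ?_⟩
    filter_upwards [self_mem_nhdsWithin] with t ht
    exact mul_ne_zero hz (ofReal_ne_zero.2 (ne_of_gt ht))
  refine hne.frequently (Eventually.frequently ?_)
  filter_upwards [Ioo_mem_nhdsGT (zero_lt_one' ℝ)] with t ht using hzero t ht

/-- A root of maximal multiplicity `2n` at the origin is strictly dominant. -/
lemma expPoly_re_neg {n : ℕ} (hn : 0 < n) {P Q : ℂ[X]} (hP : ∀ k, n + 1 ≤ k → P.coeff k = 0)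
    (hP0 : P ≠ 0) (hQ : ∀ k, n ≤ k → Q.coeff k = 0)
    (h : ((2 * n : ℕ) : ℕ∞) ≤ analyticOrderAt (expPoly P Q) 0) {z : ℂ} (hz : z ≠ 0)
    (hroot : expPoly P Q z = 0) : z.re < 0 := by
  by_contra! hre
  let E : ℂ → ℂ := fun w => exp (w / 2)
  have hE : ∀ w, HasDerivAt E (E w / 2) w := fun w => by
    simpa [E, div_eq_mul_inv] using ((hasDerivAt_id w).div_const 2).cexp
  set D := expPoly P Q with hD
  have hDd : ∀ w, HasDerivAt D (deriv D w) w :=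
    fun w => (differentiable_expPoly P Q w).hasDerivAt
  have hDdd : ∀ w, HasDerivAt (deriv D) (deriv (deriv D) w) w :=
    fun w => (analyticAt_expPoly P Q w).deriv.differentiableAt.hasDerivAt
  have hK1 : ∀ w, HasDerivAt (E * D) (E w / 2 * D w + E w * deriv D w) w :=
    fun w => (hE w).mul (hDd w)
  have hK1' : deriv (E * D) = fun w => E w / 2 * D w + E w * deriv D w :=
    funext fun w => (hK1 w).deriv
  have hK2 : ∀ w, deriv (deriv (E * D)) w = E w / 2 / 2 * D w + E w / 2 * deriv D w
      + (E w / 2 * deriv D w + E w * deriv (deriv D) w) := fun w => by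
    rw [hK1']
    exact ((((hE w).div_const 2).mul (hDd w)).add ((hE w).mul (hDdd w))).deriv
  have hzero : E * D = 0 := by
    refine eq_zero_of_whittaker (fun w => (hK1 w).differentiableAt) (N := 2 * n) (by lia) ?_ ?_ hz
      hre (by simp [hroot])
    · intro w
      rw [hK2, hK1', Pi.mul_apply]
      push_cast
      linear_combination E w * expPoly_kummer hn hP hQ h w
    · rw [analyticOrderAt_mul (Differentiable.analyticAt (fun w => (hE w).differentiableAt) 0)
        (analyticAt_expPoly P Q 0)]
      exact h.trans le_add_self
  have hD0 : D = 0 := funext fun w =>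
    (mul_eq_zero.1 (congrFun hzero w)).resolve_left (exp_ne_zero _)
  refine hP0 (expPoly_eq_zero hP hQ ?_).1
  rw [← hD, hD0, analyticOrderAt_eq_top.2 (by simp)]
  exact le_top



/-- MID for `m = n - 1`: a real root of maximal multiplicity `2n` of the quasipolynomial
`Δ(s) = sⁿ + Σ_{k<n} aₖ sᵏ + e^{-sτ} Σ_{k<n} bₖ sᵏ` is strictly dominant. -/
theorem mid_strict_dominance_m_eq_n_sub_one (n : ℕ) (hn : 0 < n) (τ : ℝ) (hτ : 0 < τ)
    (a b : ℕ → ℝ) (s₀ : ℝ)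
    (hmult : ∀ k : ℕ, k ≤ 2 * n - 1 →
      iteratedDeriv k
        (fun s : ℂ => s ^ n + (∑ j ∈ Finset.range n, (a j : ℂ) * s ^ j)
          + Complex.exp (-s * τ) * ∑ j ∈ Finset.range n, (b j : ℂ) * s ^ j) (s₀ : ℂ) = 0) :
    ∀ s : ℂ,
      s ^ n + (∑ j ∈ Finset.range n, (a j : ℂ) * s ^ j)
        + Complex.exp (-s * τ) * ∑ j ∈ Finset.range n, (b j : ℂ) * s ^ j = 0 →
      s ≠ (s₀ : ℂ) → s.re < s₀ := by
  intro s hs hne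
  set Δ : ℂ → ℂ := fun s : ℂ => s ^ n + (∑ j ∈ Finset.range n, (a j : ℂ) * s ^ j)
    + Complex.exp (-s * τ) * ∑ j ∈ Finset.range n, (b j : ℂ) * s ^ j with hΔ
  have hτ' : (τ : ℂ) ≠ 0 := ofReal_ne_zero.2 hτ.ne'
  let ℓ : ℂ[X] := C (τ : ℂ)⁻¹ * X + C (s₀ : ℂ)
  have hℓ : ℓ.natDegree = 1 := natDegree_linear (inv_ne_zero hτ')
  let A : ℂ[X] := ∑ j ∈ Finset.range n, C (a j : ℂ) * X ^ j
  let B : ℂ[X] := ∑ j ∈ Finset.range n, C (b j : ℂ) * X ^ j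
  have hdeg : ∀ c : ℕ → ℝ, (∑ j ∈ Finset.range n, C (c j : ℂ) * X ^ j).degree < (n : WithBot ℕ) :=
    fun c => (degree_sum_le _ _).trans_lt <| (Finset.sup_lt_iff (WithBot.bot_lt_coe n)).2
      fun j hj => (degree_C_mul_X_pow_le j _).trans_lt (Nat.cast_lt.2 (Finset.mem_range.1 hj))
  have hA : (X ^ n + A).natDegree = n := by
    refine natDegree_eq_of_degree_eq_some ?_
    rw [degree_add_eq_left_of_degree_lt (by rw [degree_X_pow]; exact hdeg a), degree_X_pow]
  have hB : B.natDegree < n := by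
    rcases eq_or_ne B 0 with h0 | h0
    · simpa [h0] using hn
    · exact (natDegree_lt_iff_degree_lt h0).2 (hdeg b)
  let P : ℂ[X] := (X ^ n + A).comp ℓ
  let Q : ℂ[X] := C (Complex.exp (-s₀ * τ)) * B.comp ℓ
  have hP : P.natDegree = n := by rw [natDegree_comp, hA, hℓ, mul_one]
  have hQ : Q.natDegree < n := by
    refine (natDegree_C_mul_le _ _).trans_lt ?_
    rwa [natDegree_comp, hℓ, mul_one]
  have hcomp : expPoly P Q = Δ ∘ fun z : ℂ => (τ : ℂ)⁻¹ * z + s₀ := by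
    funext z
    have hexp : Complex.exp (-((τ : ℂ)⁻¹ * z + s₀) * τ)
        = Complex.exp (-z) * Complex.exp (-s₀ * τ) := by
      rw [← Complex.exp_add]
      congr 1
      field_simp
      ring
    simp only [expPoly, P, Q, A, B, ℓ, hΔ, Function.comp_apply, hexp, eval_comp, eval_add, eval_mul,
      eval_pow, eval_X, eval_C, eval_finsetSum, mul_assoc]
  have hord : ((2 * n : ℕ) : ℕ∞) ≤ analyticOrderAt (expPoly P Q) 0 := by
    have hd : HasDerivAt (fun z : ℂ => (τ : ℂ)⁻¹ * z + s₀) (τ : ℂ)⁻¹ 0 := by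
      simpa using ((hasDerivAt_id (0 : ℂ)).const_mul (τ : ℂ)⁻¹).add_const (s₀ : ℂ)
    rw [hcomp, analyticOrderAt_comp_of_deriv_ne_zero (by fun_prop)
      (by rw [hd.deriv]; exact inv_ne_zero hτ'), mul_zero, zero_add,
      natCast_le_analyticOrderAt_iff_iteratedDeriv_eq_zero
        (Differentiable.analyticAt (by fun_prop) _)]
    exact fun k hk => hmult k (by lia)
  have hroot : expPoly P Q (τ * (s - s₀)) = 0 := by
    rw [hcomp, Function.comp_apply, inv_mul_cancel_left₀ hτ', sub_add_cancel]
    exact hs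
  have hneg := expPoly_re_neg hn (fun k hk => coeff_eq_zero_of_natDegree_lt (by lia))
    (by intro h0; rw [h0, natDegree_zero] at hP; lia)
    (fun k hk => coeff_eq_zero_of_natDegree_lt (by lia)) hord
    (mul_ne_zero hτ' (sub_ne_zero.2 hne)) hroot
  rw [re_ofReal_mul, sub_re, ofReal_re] at hneg
  nlinarith
end

section
/- Let τ > 0 and a_0, a_1, b_0 ∈ ℝ, and consider the quasipolynomial Δ(s) = s² + a_1 s + a_0 + b_0 e^{-sτ} (case n = 2, m = 0). If a real number s_0 is a root of Δ of multiplicity 3 (i.e., Δ(s_0) = Δ'(s_0) = Δ''(s_0) = 0), then s_0 is dominant: every root s ∈ ℂ of Δ satisfies Re s ≤ s_0. -/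
open Complex

/-- If `F' ≥ 0` on `(0, 1)` and `F 0 = F 1`, then `F'` vanishes on `(0, 1)`. -/
lemma deriv_eq_zero_of_nonneg_of_endpoints_eq {F F' : ℝ → ℝ}
    (hF : ∀ t, HasDerivAt F (F' t) t) (hF' : ∀ t ∈ Set.Ioo (0 : ℝ) 1, 0 ≤ F' t)
    (h01 : F 0 = F 1) {t : ℝ} (ht : t ∈ Set.Ioo (0 : ℝ) 1) : F' t = 0 := by
  have hmono : MonotoneOn F (Set.Icc 0 1) := by
    refine monotoneOn_of_deriv_nonneg (convex_Icc 0 1)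
      (fun u _ => (hF u).continuousAt.continuousWithinAt)
      (fun u _ => (hF u).differentiableAt.differentiableWithinAt) fun u hu => ?_
    rw [interior_Icc] at hu
    rw [(hF u).deriv]
    exact hF' u hu
  have hconst : F =ᶠ[nhds t] fun _ => F 0 := by
    filter_upwards [Ioo_mem_nhds ht.1 ht.2] with u hu
    have hu' := Set.Ioo_subset_Icc_self hu
    refine le_antisymm ?_ (hmono (by simp) hu' hu'.1)
    rw [h01]
    exact hmono hu' (by simp) hu'.2
  exact (hF t).unique ((hasDerivAt_const t (F 0)).congr_of_eventuallyEq hconst)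

/-- A primitive of `w ↦ (1 - w) ^ 2 * exp (-w z)`. -/
lemma hasDerivAt_sq_mul_exp_primitive {z : ℂ} (hz : z ≠ 0) (w : ℂ) :
    HasDerivAt
      (fun w : ℂ => -(exp (-w * z) * ((1 - w) ^ 2 / z - 2 * (1 - w) / z ^ 2 + 2 / z ^ 3)))
      ((1 - w) ^ 2 * exp (-w * z)) w := by
  have hl : HasDerivAt (fun w : ℂ => 1 - w) (-1) w := (hasDerivAt_id w).const_sub 1
  have he : HasDerivAt (fun w : ℂ => exp (-w * z)) (exp (-w * z) * (-1 * z)) w :=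
    ((hasDerivAt_id w).neg.mul_const z).cexp
  have hp := (((hl.pow 2).div_const z).sub ((hl.const_mul 2).div_const (z ^ 2))).add_const
    (2 / z ^ 3)
  refine (he.mul hp).neg.congr_deriv ?_
  simp
  field_simp
  ring

/-- The normalized quasipolynomial `z² - 2z + 2 - 2e^{-z}` has no root in the open right
half-plane. -/
lemma re_nonpos_of_normalized_root {z : ℂ} (hz : z ^ 2 - 2 * z + 2 - 2 * exp (-z) = 0) :
    z.re ≤ 0 := by
  by_contra! hx
  have hz0 : z ≠ 0 := by rintro rfl; simp at hx
  obtain ⟨x, hxz⟩ : ∃ x, x = z.re := ⟨_, rfl⟩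
  obtain ⟨y, hyz⟩ : ∃ y, y = z.im := ⟨_, rfl⟩
  rw [← hxz] at hx
  by_cases hy : y = 0
  · have hzx : z = (x : ℂ) := by apply Complex.ext <;> simp [← hxz, ← hyz, hy]
    have hreal : x ^ 2 - 2 * x + 2 - 2 * Real.exp (-x) = 0 := by
      rw [hzx] at hz
      exact_mod_cast hz
    have hexp := Real.quadratic_le_exp_of_nonneg hx.le
    have hmul : Real.exp x * Real.exp (-x) = 1 := by rw [← Real.exp_add]; simp
    have hpos : 0 < x ^ 4 := by positivity
    nlinarith [mul_le_mul_of_nonneg_right hexp (Real.exp_pos (-x)).le]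
  let G : ℂ → ℂ := fun w =>
    -(exp (-w * z) * ((1 - w) ^ 2 / z - 2 * (1 - w) / z ^ 2 + 2 / z ^ 3))
  have hG : ∀ t : ℝ, HasDerivAt (fun t : ℝ => (G t).re)
      ((1 - t) ^ 2 * (Real.exp (-t * x) * Real.cos (t * y))) t := by
    intro t
    refine (hasDerivAt_sq_mul_exp_primitive hz0 (t : ℂ)).real_of_complex.congr_deriv ?_
    have hsq : ((1 - (t : ℂ)) ^ 2) = (((1 - t) ^ 2 : ℝ) : ℂ) := by push_cast; rfl
    rw [hsq, re_ofReal_mul, exp_re]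
    simp [← hxz, ← hyz]
  have hG01 : (G (0 : ℝ)).re = (G (1 : ℝ)).re := by
    congr 1
    simp only [G]
    norm_num
    field_simp
    linear_combination -hz
  -- `g` is the weight `(1 - t)² e^{-xt}`, with derivatives `g'` and `g''`.
  let g : ℝ → ℝ := fun t => (1 - t) ^ 2 * Real.exp (-t * x)
  let g' : ℝ → ℝ := fun t => (-2 * (1 - t) - x * (1 - t) ^ 2) * Real.exp (-t * x)
  let g'' : ℝ → ℝ := fun t => (2 + 4 * x * (1 - t) + x ^ 2 * (1 - t) ^ 2) * Real.exp (-t * x)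
  have hl : ∀ t : ℝ, HasDerivAt (fun t : ℝ => 1 - t) (-1) t :=
    fun t => (hasDerivAt_id t).const_sub 1
  have he : ∀ t : ℝ, HasDerivAt (fun t : ℝ => Real.exp (-t * x))
      (Real.exp (-t * x) * (-1 * x)) t :=
    fun t => ((hasDerivAt_id t).neg.mul_const x).exp
  have hg : ∀ t, HasDerivAt g (g' t) t := fun t => by
    refine (((hl t).pow 2).mul (he t)).congr_deriv ?_
    simp [g']
    ring
  have hg' : ∀ t, HasDerivAt g' (g'' t) t := fun t => by
    refine ((((hl t).const_mul (-2)).sub (((hl t).pow 2).const_mul x)).mul (he t)).congr_deriv ?_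
    simp [g'']
    ring
  have hlin : ∀ t : ℝ, HasDerivAt (fun t : ℝ => t * y) (1 * y) t :=
    fun t => (hasDerivAt_id t).mul_const y
  let F : ℝ → ℝ := fun t =>
    y ^ 2 * (G t).re - y * (g t * Real.sin (t * y)) - g' t * Real.cos (t * y) + g' t
  have hF : ∀ t, HasDerivAt F (g'' t * (1 - Real.cos (t * y))) t := fun t => by
    refine (((((hG t).const_mul (y ^ 2)).sub (((hg t).mul (hlin t).sin).const_mul y)).sub
      ((hg' t).mul (hlin t).cos)).add (hg' t)).congr_deriv ?_
    simp only [g]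
    ring
  have hg''pos : ∀ t ∈ Set.Ioo (0 : ℝ) 1, 0 < g'' t := fun t ht => by
    have : 0 < 1 - t := sub_pos.2 ht.2
    simp only [g'']
    positivity
  have hF01 : F 0 = F 1 := by
    simp only [F, hG01]
    simp [g, g']
  have hy' : 0 < |y| := abs_pos.2 hy
  have ht : 1 / (1 + |y|) ∈ Set.Ioo (0 : ℝ) 1 :=
    ⟨by positivity, by rw [div_lt_one (by positivity)]; linarith⟩
  have hzero := deriv_eq_zero_of_nonneg_of_endpoints_eq hF
    (fun t ht => mul_nonneg (hg''pos t ht).le (sub_nonneg.2 (Real.cos_le_one _))) hF01 ht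
  have hcos : Real.cos (1 / (1 + |y|) * y) = 1 := by
    have := (mul_eq_zero.1 hzero).resolve_left (hg''pos _ ht).ne'
    linarith
  have habs : |1 / (1 + |y|) * y| < 1 := by
    rw [abs_mul, abs_of_pos ht.1, one_div_mul_eq_div, div_lt_one (by positivity)]
    linarith
  have hpi := Real.pi_gt_three
  rw [Real.cos_eq_one_iff_of_lt_of_lt (by linarith [(abs_lt.1 habs).1])
    (by linarith [(abs_lt.1 habs).2])] at hcos
  exact (mul_ne_zero ht.1.ne' hy) hcos

/-- MID for `n = 2`, `m = 0`: a real triple root of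
`Δ(s) = s² + a₁ s + a₀ + b₀ e^{-sτ}` is dominant. -/
theorem mid_dominance_n2_m0 (τ : ℝ) (hτ : 0 < τ) (a₀ a₁ b₀ : ℝ) (s₀ : ℝ)
    (h0 : iteratedDeriv 0 (fun s : ℂ => s ^ 2 + (a₁ : ℂ) * s + (a₀ : ℂ)
      + (b₀ : ℂ) * Complex.exp (-s * τ)) (s₀ : ℂ) = 0)
    (h1 : iteratedDeriv 1 (fun s : ℂ => s ^ 2 + (a₁ : ℂ) * s + (a₀ : ℂ)
      + (b₀ : ℂ) * Complex.exp (-s * τ)) (s₀ : ℂ) = 0)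
    (h2 : iteratedDeriv 2 (fun s : ℂ => s ^ 2 + (a₁ : ℂ) * s + (a₀ : ℂ)
      + (b₀ : ℂ) * Complex.exp (-s * τ)) (s₀ : ℂ) = 0) :
    ∀ s : ℂ, s ^ 2 + (a₁ : ℂ) * s + (a₀ : ℂ) + (b₀ : ℂ) * Complex.exp (-s * τ) = 0 →
      s.re ≤ s₀ := by
  intro s hs
  have he : ∀ w : ℂ, HasDerivAt (fun s : ℂ => exp (-s * τ)) (exp (-w * τ) * (-1 * τ)) w :=
    fun w => ((hasDerivAt_id w).neg.mul_const (τ : ℂ)).cexp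
  have hd1 : deriv (fun s : ℂ => s ^ 2 + (a₁ : ℂ) * s + (a₀ : ℂ) + (b₀ : ℂ) * exp (-s * τ))
      = fun s => 2 * s + a₁ + b₀ * (exp (-s * τ) * (-1 * τ)) := by
    funext w
    refine (((((hasDerivAt_id w).pow 2).add ((hasDerivAt_id w).const_mul (a₁ : ℂ))).add_const
      (a₀ : ℂ)).add ((he w).const_mul (b₀ : ℂ))).deriv.trans ?_
    simp
  have hd2 : deriv (fun s : ℂ => 2 * s + a₁ + b₀ * (exp (-s * τ) * (-1 * τ))) s₀
      = 2 + b₀ * (exp (-s₀ * τ) * (-1 * τ) * (-1 * τ)) := by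
    refine ((((hasDerivAt_id (s₀ : ℂ)).const_mul 2).add_const (a₁ : ℂ)).add
      (((he s₀).mul_const (-1 * (τ : ℂ))).const_mul (b₀ : ℂ))).deriv.trans ?_
    simp
  rw [iteratedDeriv_zero] at h0
  rw [iteratedDeriv_one, hd1] at h1
  rw [iteratedDeriv_succ, iteratedDeriv_one, hd1, hd2] at h2
  have hexp : exp (-s * τ) = exp (-s₀ * τ) * exp (-(τ * (s - s₀))) := by
    rw [← exp_add]
    ring_nf
  rw [hexp] at hs
  have key := re_nonpos_of_normalized_root (z := τ * (s - s₀)) (by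
    linear_combination (τ : ℂ) ^ 2 * hs - (τ : ℂ) ^ 2 * h0 - (τ : ℂ) ^ 2 * (s - s₀) * h1
      - (exp (-(τ * (s - s₀))) - 1 + τ * (s - s₀)) * h2)
  rw [re_ofReal_mul, sub_re, ofReal_re] at key
  nlinarith
end

section
/- Let τ > 0 and a_0, a_1, b_0, b_1 ∈ ℝ, and consider the quasipolynomial Δ(s) = s² + a_1 s + a_0 + e^{-sτ}(b_1 s + b_0) (case n = 2, m = 1). If a real number s_0 is a root of Δ of the maximal multiplicity 4 (i.e., Δ(s_0) = Δ'(s_0) = Δ''(s_0) = Δ'''(s_0) = 0), then s_0 is strictly dominant: every root s ∈ ℂ of Δ with s ≠ s_0 satisfies Re s < s_0. -/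
open Complex

lemma deriv_quadratic_add_exp_mul_linear (τ α β γ p q : ℂ) :
    deriv (fun s : ℂ => α * s ^ 2 + β * s + γ + exp (-s * τ) * (p * s + q)) =
      fun s : ℂ => 0 * s ^ 2 + 2 * α * s + β + exp (-s * τ) * (-τ * p * s + (p - τ * q)) := by
  funext s
  have hid := hasDerivAt_id s
  have h1 := (((hid.pow 2).const_mul α).add (hid.const_mul β)).add_const γ
  have h2 := ((hid.neg.mul_const τ).cexp).mul ((hid.const_mul p).add_const q)
  refine ((h1.add h2).congr_deriv ?_).deriv
  simp
  ring

/-- Integral form of the remainder of the `[2/1]` Padé approximation of `exp (-z)` at `0`. -/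
lemma pow_four_mul_integral_exp (z : ℂ) :
    z ^ 4 * ∫ t in (0 : ℝ)..1, exp (-z * t) * ((t * (1 - t) ^ 2 : ℝ) : ℂ) =
      z ^ 2 - 4 * z + 6 - exp (-z) * (2 * z + 6) := by
  have hderiv : ∀ t ∈ Set.uIcc (0 : ℝ) 1,
      HasDerivAt (fun t : ℝ => exp (-z * t) *
        -(z ^ 3 * (t - 2 * t ^ 2 + t ^ 3) + z ^ 2 * (1 - 4 * t + 3 * t ^ 2) + z * (-4 + 6 * t) + 6))
        (z ^ 4 * (exp (-z * t) * ((t * (1 - t) ^ 2 : ℝ) : ℂ))) t := by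
    intro t _
    have hid : HasDerivAt (fun t : ℝ => (t : ℂ)) 1 t := Complex.ofRealCLM.hasDerivAt
    have h1 := (hid.const_mul (-z)).cexp
    have h2 := ((hid.sub ((hid.pow 2).const_mul 2)).add (hid.pow 3)).const_mul (z ^ 3)
    have h3 := (((hid.const_mul 4).const_sub 1).add ((hid.pow 2).const_mul 3)).const_mul (z ^ 2)
    have h4 := ((hid.const_mul 6).const_add (-4)).const_mul z
    refine (h1.mul (((h2.add h3).add h4).add_const 6).neg).congr_deriv ?_
    simp
    ring
  rw [← intervalIntegral.integral_const_mul, intervalIntegral.integral_eq_sub_of_hasDerivAt hderiv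
    (Continuous.intervalIntegrable (by fun_prop) _ _)]
  simp
  ring

lemma integral_exp_re_pos (x : ℝ) :
    0 < ∫ t in (0 : ℝ)..1, Real.exp (-x * t) * (t * (1 - t) ^ 2) := by
  refine intervalIntegral.intervalIntegral_pos_of_pos_on
    (Continuous.intervalIntegrable (by fun_prop) _ _) (fun t ht => ?_) one_pos
  have := ht.1
  have : 0 < 1 - t := sub_pos.2 ht.2
  positivity

/-- The Padé remainder is nonnegative on the real axis. -/
lemma exp_neg_mul_le_quadratic (x : ℝ) :
    Real.exp (-x) * (2 * x + 6) ≤ x ^ 2 - 4 * x + 6 := by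
  have h := pow_four_mul_integral_exp x
  have hI : ∫ t in (0 : ℝ)..1, exp (-(x : ℂ) * t) * ((t * (1 - t) ^ 2 : ℝ) : ℂ) =
      ((∫ t in (0 : ℝ)..1, Real.exp (-x * t) * (t * (1 - t) ^ 2) : ℝ) : ℂ) := by
    rw [← intervalIntegral.integral_ofReal]
    simp
  rw [hI] at h
  have h' : x ^ 4 * (∫ t in (0 : ℝ)..1, Real.exp (-x * t) * (t * (1 - t) ^ 2)) =
      x ^ 2 - 4 * x + 6 - Real.exp (-x) * (2 * x + 6) := by exact_mod_cast h
  have := mul_nonneg (by positivity : 0 ≤ x ^ 4) (integral_exp_re_pos x).le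
  linarith

lemma integral_exp_ne_zero_of_abs_im_lt_pi {z : ℂ} (hz : |z.im| < Real.pi) :
    ∫ t in (0 : ℝ)..1, exp (-z * t) * ((t * (1 - t) ^ 2 : ℝ) : ℂ) ≠ 0 := by
  intro h
  have hint : IntervalIntegrable (fun t : ℝ => exp (-z * t) * ((t * (1 - t) ^ 2 : ℝ) : ℂ))
      MeasureTheory.volume 0 1 := Continuous.intervalIntegrable (by fun_prop) _ _
  by_cases hy : z.im = 0
  · have hre := Complex.reCLM.intervalIntegral_comp_comm hint
    rw [h] at hre
    have : ∀ t : ℝ, reCLM (exp (-z * t) * ((t * (1 - t) ^ 2 : ℝ) : ℂ)) =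
        Real.exp (-z.re * t) * (t * (1 - t) ^ 2) := by
      intro t
      rw [reCLM_apply, re_mul_ofReal, exp_re]
      simp [hy]
    simp only [this, map_zero] at hre
    exact (integral_exp_re_pos z.re).ne' hre
  · have him := Complex.imCLM.intervalIntegral_comp_comm hint
    rw [h] at him
    have : ∀ t : ℝ, imCLM (exp (-z * t) * ((t * (1 - t) ^ 2 : ℝ) : ℂ)) =
        -(Real.exp (-z.re * t) * Real.sin (z.im * t) * (t * (1 - t) ^ 2)) := by
      intro t
      rw [imCLM_apply, im_mul_ofReal, exp_im]
      simp
    simp only [this, map_zero, intervalIntegral.integral_neg, neg_eq_zero] at him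
    have hpos : 0 < ∫ t in (0 : ℝ)..1,
        z.im * (Real.exp (-z.re * t) * Real.sin (z.im * t) * (t * (1 - t) ^ 2)) := by
      refine intervalIntegral.intervalIntegral_pos_of_pos_on
        (Continuous.intervalIntegrable (by fun_prop) _ _) (fun t ht => ?_) one_pos
      have ht0 := ht.1
      have ht1 : 0 < 1 - t := sub_pos.2 ht.2
      have hsin : 0 < z.im * Real.sin (z.im * t) := by
        obtain ⟨h1, h2⟩ := abs_lt.1 hz
        rcases lt_or_gt_of_ne hy with hneg | hpos
        · exact mul_pos_of_neg_of_neg hneg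
            (Real.sin_neg_of_neg_of_neg_pi_lt (mul_neg_of_neg_of_pos hneg ht0) (by nlinarith))
        · exact mul_pos hpos (Real.sin_pos_of_pos_of_lt_pi (mul_pos hpos ht0) (by nlinarith))
      have : 0 < (z.im * Real.sin (z.im * t)) * (Real.exp (-z.re * t) * (t * (1 - t) ^ 2)) := by
        positivity
      linarith
    rw [intervalIntegral.integral_const_mul, him, mul_zero] at hpos
    exact hpos.false

lemma im_sq_le_eight_of_root {z : ℂ} (hx : 0 ≤ z.re)
    (hz : z ^ 2 - 4 * z + 6 = exp (-z) * (2 * z + 6)) : z.im ^ 2 ≤ 8 := by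
  have hnorm := congrArg normSq hz
  rw [normSq_mul, normSq_eq_norm_sq (exp (-z)), norm_exp] at hnorm
  simp only [normSq_apply, pow_two, add_re, sub_re, mul_re, add_im, sub_im, mul_im, re_ofNat,
    im_ofNat, neg_re] at hnorm
  have hle := exp_neg_mul_le_quadratic z.re
  have he1 : Real.exp (-z.re) ≤ 1 := Real.exp_le_one_iff.2 (by linarith)
  have he0 := Real.exp_pos (-z.re)
  set x := z.re
  set y := z.im
  set e := Real.exp (-x)
  have hsq : (e * (2 * x + 6)) ^ 2 ≤ (x ^ 2 - 4 * x + 6) ^ 2 :=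
    pow_le_pow_left₀ (by positivity) hle 2
  have hee : e ^ 2 ≤ 1 := pow_le_one₀ he0.le he1
  by_contra! hy
  have hfac : 0 < y ^ 2 * (y ^ 2 - 4 + 2 * (x - 2) ^ 2 - 4 * e ^ 2) :=
    mul_pos (by linarith) (by nlinarith [sq_nonneg (x - 2)])
  linarith

lemma re_neg_of_root {z : ℂ} (hz0 : z ≠ 0)
    (hz : z ^ 2 - 4 * z + 6 = exp (-z) * (2 * z + 6)) : z.re < 0 := by
  by_contra! hx
  have hy := im_sq_le_eight_of_root hx hz
  have hpi : |z.im| < Real.pi :=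
    (abs_lt_of_sq_lt_sq (by linarith) (by norm_num : (0 : ℝ) ≤ 3)).trans Real.pi_gt_three
  have h := pow_four_mul_integral_exp z
  rw [hz, sub_self] at h
  exact mul_ne_zero (pow_ne_zero 4 hz0) (integral_exp_ne_zero_of_abs_im_lt_pi hpi) h

/-- MID for `n = 2`, `m = 1`: a real root of maximal multiplicity 4 of
`Δ(s) = s² + a₁ s + a₀ + e^{-sτ}(b₁ s + b₀)` is strictly dominant. -/
theorem mid_strict_dominance_n2_m1 (τ : ℝ) (hτ : 0 < τ) (a₀ a₁ b₀ b₁ : ℝ) (s₀ : ℝ)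
    (hmult : ∀ k : ℕ, k ≤ 3 →
      iteratedDeriv k (fun s : ℂ => s ^ 2 + (a₁ : ℂ) * s + (a₀ : ℂ)
        + Complex.exp (-s * τ) * ((b₁ : ℂ) * s + (b₀ : ℂ))) (s₀ : ℂ) = 0) :
    ∀ s : ℂ,
      s ^ 2 + (a₁ : ℂ) * s + (a₀ : ℂ)
        + Complex.exp (-s * τ) * ((b₁ : ℂ) * s + (b₀ : ℂ)) = 0 →
      s ≠ (s₀ : ℂ) → s.re < s₀ := by
  intro s hs hne
  have hτ' : (τ : ℂ) ≠ 0 := ofReal_ne_zero.2 hτ.ne'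
  have hfun : (fun s : ℂ => s ^ 2 + (a₁ : ℂ) * s + (a₀ : ℂ)
      + exp (-s * τ) * ((b₁ : ℂ) * s + (b₀ : ℂ))) = fun s : ℂ => 1 * s ^ 2 + (a₁ : ℂ) * s + (a₀ : ℂ)
      + exp (-s * τ) * ((b₁ : ℂ) * s + (b₀ : ℂ)) := by
    simp only [one_mul]
  rw [hfun] at hmult
  have h0 := hmult 0 (by norm_num)
  have h1 := hmult 1 (by norm_num)
  have h2 := hmult 2 (by norm_num)
  have h3 := hmult 3 (by norm_num)
  simp only [iteratedDeriv_succ', iteratedDeriv_zero, deriv_quadratic_add_exp_mul_linear]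
    at h0 h1 h2 h3
  have hexp : exp (-s * τ) = exp (-s₀ * τ) * exp (-(τ * (s - s₀))) := by
    rw [← Complex.exp_add]
    ring_nf
  rw [hexp] at hs
  set E := exp (-(s₀ : ℂ) * τ)
  have hb₁ : τ * (E * b₁) = -2 := by
    apply mul_left_cancel₀ hτ'
    linear_combination τ * h2 + h3
  have hB : τ ^ 2 * (E * (b₁ * s₀ + b₀)) = -6 := by
    linear_combination h2 + 2 * hb₁
  have hroot : (τ * (s - s₀)) ^ 2 - 4 * (τ * (s - s₀)) + 6 =
      exp (-(τ * (s - s₀))) * (2 * (τ * (s - s₀)) + 6) := by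
    set w := exp (-(τ * (s - s₀)))
    linear_combination τ ^ 2 * hs - τ ^ 2 * h0 - τ ^ 2 * (s - s₀) * h1
      + τ * (s - s₀) * (1 - w) * hb₁ + (1 - w - τ * (s - s₀)) * hB
  have hre := re_neg_of_root (mul_ne_zero hτ' (sub_ne_zero.2 hne)) hroot
  rw [re_ofReal_mul, sub_re, ofReal_re] at hre
  nlinarith
end

section
/- Let τ > 0 and a_0, b_0 ∈ ℝ, and consider the quasipolynomial Δ(s) = s + a_0 + b_0 e^{-sτ} (case n = 1, m = 0). If Δ admits two distinct real roots s_1 > s_2, then s_1 is dominant: every root s ∈ ℂ of Δ satisfies Re s ≤ s_1. -/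
open Complex

/-- If `s + a + b e^{-sτ}` has two distinct real roots `s₂ < s₁`, then `b > 0` and its derivative
`1 - b τ e^{-sτ}` is positive at the larger root. -/
theorem pos_and_mul_exp_lt_one_of_two_roots {τ a b s₁ s₂ : ℝ} (hτ : 0 < τ) (h12 : s₂ < s₁)
    (h₁ : s₁ + a + b * Real.exp (-s₁ * τ) = 0) (h₂ : s₂ + a + b * Real.exp (-s₂ * τ) = 0) :
    0 < b ∧ b * Real.exp (-s₁ * τ) * τ < 1 := by
  have hd : 0 < s₁ - s₂ := sub_pos.2 h12
  have hsplit : Real.exp (-s₂ * τ) = Real.exp (-s₁ * τ) * Real.exp ((s₁ - s₂) * τ) := by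
    rw [← Real.exp_add]; ring_nf
  have hexp : (s₁ - s₂) * τ + 1 < Real.exp ((s₁ - s₂) * τ) :=
    Real.add_one_lt_exp (mul_pos hd hτ).ne'
  have hE := Real.exp_pos (-s₁ * τ)
  have hdτ := mul_pos hd hτ
  have hkey : b * Real.exp (-s₁ * τ) * (Real.exp ((s₁ - s₂) * τ) - 1) = s₁ - s₂ := by
    rw [hsplit] at h₂; linarith
  have hc : 0 < b * Real.exp (-s₁ * τ) :=
    pos_of_mul_pos_left (hkey ▸ hd) (by linarith)
  refine ⟨pos_of_mul_pos_left hc hE.le, ?_⟩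
  have hlt := mul_lt_mul_of_pos_left (lt_sub_iff_add_lt.2 hexp) hc
  rw [hkey] at hlt
  by_contra! hge
  nlinarith [mul_le_mul_of_nonneg_left hge hd.le]

/-- CRRID for `(n, m) = (1, 0)`: if `Δ(s) = s + a₀ + b₀ e^{-sτ}` admits two distinct
real roots `s₁ > s₂`, then `s₁` is dominant. -/
theorem crrid_n1_m0 (τ : ℝ) (hτ : 0 < τ) (a₀ b₀ : ℝ) (s₁ s₂ : ℝ) (h12 : s₂ < s₁)
    (h₁ : (s₁ : ℂ) + (a₀ : ℂ) + (b₀ : ℂ) * Complex.exp (-(s₁ : ℂ) * τ) = 0)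
    (h₂ : (s₂ : ℂ) + (a₀ : ℂ) + (b₀ : ℂ) * Complex.exp (-(s₂ : ℂ) * τ) = 0) :
    ∀ s : ℂ, s + (a₀ : ℂ) + (b₀ : ℂ) * Complex.exp (-s * τ) = 0 → s.re ≤ s₁ := by
  intro s hs
  by_contra! hlt
  have hr₁ : s₁ + a₀ + b₀ * Real.exp (-s₁ * τ) = 0 := by exact_mod_cast h₁
  have hr₂ : s₂ + a₀ + b₀ * Real.exp (-s₂ * τ) = 0 := by exact_mod_cast h₂
  obtain ⟨hb, hc⟩ := pos_and_mul_exp_lt_one_of_two_roots hτ h12 hr₁ hr₂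
  have hre : s.re + a₀ + b₀ * (Real.exp (-s.re * τ) * Real.cos (s.im * τ)) = 0 := by
    simpa [Complex.exp_re] using congrArg Complex.re hs
  have him : s.im = b₀ * Real.exp (-s.re * τ) * Real.sin (s.im * τ) := by
    have h := congrArg Complex.im hs
    simp [Complex.exp_im] at h
    rw [neg_mul]
    linarith
  have hmono : Real.exp (-s.re * τ) < Real.exp (-s₁ * τ) :=
    Real.exp_lt_exp.2 (by nlinarith)
  have hE := Real.exp_pos (-s.re * τ)
  have hbE : b₀ * Real.exp (-s.re * τ) * τ < 1 :=
    lt_trans (by gcongr) hc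
  have him0 : s.im = 0 := by
    by_contra hne
    have habs : |s.im| ≤ b₀ * Real.exp (-s.re * τ) * τ * |s.im| := by
      calc |s.im| = b₀ * Real.exp (-s.re * τ) * |Real.sin (s.im * τ)| := by
            conv_lhs => rw [him, abs_mul, abs_of_pos (mul_pos hb hE)]
        _ ≤ b₀ * Real.exp (-s.re * τ) * |s.im * τ| :=
            mul_le_mul_of_nonneg_left Real.abs_sin_le_abs (mul_pos hb hE).le
        _ = b₀ * Real.exp (-s.re * τ) * τ * |s.im| := by
            rw [abs_mul, abs_of_pos hτ]; ring
    nlinarith [abs_pos.2 hne]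
  rw [him0, zero_mul, Real.cos_zero, mul_one] at hre
  have hexp : 1 - (s.re - s₁) * τ ≤ Real.exp (-(s.re - s₁) * τ) := by
    have := Real.add_one_le_exp (-(s.re - s₁) * τ)
    linarith
  have hsplit : Real.exp (-s.re * τ) = Real.exp (-s₁ * τ) * Real.exp (-(s.re - s₁) * τ) := by
    rw [← Real.exp_add]; ring_nf
  rw [hsplit] at hre
  have hle := mul_le_mul_of_nonneg_left hexp (mul_pos hb (Real.exp_pos (-s₁ * τ))).le
  have hcd := mul_lt_mul_of_pos_right hc (sub_pos.2 hlt)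
  linarith
end

section
/- Let τ > 0 and a_0, a_1, b_0 ∈ ℝ, and consider the quasipolynomial Δ(s) = s² + a_1 s + a_0 + b_0 e^{-sτ} (case n = 2, m = 0). If Δ admits three distinct real roots s_1 > s_2 > s_3, then s_1 is dominant: every root s ∈ ℂ of Δ satisfies Re s ≤ s_1. -/
open Complex

/-- Integral form of the divided difference of `z ↦ e^{-zτ}` at `s` and `r`. -/
theorem sub_mul_integral_exp_segment (τ : ℝ) (s r : ℂ) :
    (s - r) * (τ * ∫ t in (0 : ℝ)..1, Complex.exp (-(t * s + (1 - t) * r) * τ)) =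
      Complex.exp (-r * τ) - Complex.exp (-s * τ) := by
  have hderiv : ∀ t ∈ Set.uIcc (0 : ℝ) 1,
      HasDerivAt (fun t : ℝ ↦ -Complex.exp (-(t * s + (1 - t) * r) * τ))
        ((s - r) * τ * Complex.exp (-(t * s + (1 - t) * r) * τ)) t := by
    intro t _
    have ht : HasDerivAt (fun t : ℝ ↦ (t : ℂ)) 1 t := ofRealCLM.hasDerivAt
    have h := ((((ht.mul_const s).add ((ht.const_sub 1).mul_const r)).neg.mul_const
      (τ : ℂ)).cexp).neg
    refine h.congr_deriv ?_
    simp only [Pi.add_apply, Pi.neg_apply]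
    ring
  have h := intervalIntegral.integral_eq_sub_of_hasDerivAt hderiv
    (Continuous.intervalIntegrable (by fun_prop) _ _)
  rw [intervalIntegral.integral_const_mul] at h
  rw [← mul_assoc, h]
  simp
  ring

/-- The divided difference of a quadratic quasipolynomial vanishes at two distinct roots. -/
theorem mul_integral_exp_segment_eq_of_roots {τ : ℝ} {a₀ a₁ b₀ s r : ℂ} (hne : s ≠ r)
    (hs : s ^ 2 + a₁ * s + a₀ + b₀ * Complex.exp (-s * τ) = 0)
    (hr : r ^ 2 + a₁ * r + a₀ + b₀ * Complex.exp (-r * τ) = 0) :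
    b₀ * (τ * ∫ t in (0 : ℝ)..1, Complex.exp (-(t * s + (1 - t) * r) * τ)) = s + r + a₁ := by
  apply mul_left_cancel₀ (sub_ne_zero.mpr hne)
  linear_combination b₀ * sub_mul_integral_exp_segment τ s r + hr - hs

/-- The second divided difference of a quadratic quasipolynomial vanishes at three roots
`s`, `r₁`, `r₂`, written with a kernel that is nonnegative when `r₂ ≤ r₁` are real. -/
theorem mul_integral_exp_kernel_eq_of_roots {τ : ℝ} {a₀ a₁ b₀ s : ℂ} {r₁ r₂ : ℝ}
    (hne₁ : s ≠ r₁) (hne₂ : s ≠ r₂)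
    (hs : s ^ 2 + a₁ * s + a₀ + b₀ * Complex.exp (-s * τ) = 0)
    (hr₁ : (r₁ : ℂ) ^ 2 + a₁ * r₁ + a₀ + b₀ * Complex.exp (-(r₁ : ℂ) * τ) = 0)
    (hr₂ : (r₂ : ℂ) ^ 2 + a₁ * r₂ + a₀ + b₀ * Complex.exp (-(r₂ : ℂ) * τ) = 0) :
    b₀ * (τ * ∫ t in (0 : ℝ)..1, Complex.exp (-(t * s) * τ) *
      ((Real.exp (-((1 - t) * r₂) * τ) - Real.exp (-((1 - t) * r₁) * τ) : ℝ) : ℂ)) =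
      r₂ - r₁ := by
  have h : (∫ t in (0 : ℝ)..1, Complex.exp (-(t * s) * τ) *
      ((Real.exp (-((1 - t) * r₂) * τ) - Real.exp (-((1 - t) * r₁) * τ) : ℝ) : ℂ)) =
      (∫ t in (0 : ℝ)..1, Complex.exp (-(t * s + (1 - t) * r₂) * τ)) -
        ∫ t in (0 : ℝ)..1, Complex.exp (-(t * s + (1 - t) * r₁) * τ) := by
    rw [← intervalIntegral.integral_sub (Continuous.intervalIntegrable (by fun_prop) _ _)
      (Continuous.intervalIntegrable (by fun_prop) _ _)]
    congr 1
    ext t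
    push_cast
    rw [mul_sub, ← Complex.exp_add, ← Complex.exp_add]
    ring_nf
  rw [h]
  linear_combination mul_integral_exp_segment_eq_of_roots hne₂ hs hr₂ -
    mul_integral_exp_segment_eq_of_roots hne₁ hs hr₁

/-- A Laplace-type integral with positive kernel is strictly larger at a real point than at any
complex point further to the right. -/
theorem norm_integral_exp_mul_lt {τ : ℝ} (hτ : 0 < τ) {g : ℝ → ℝ} (hg : Continuous g)
    (hg_nonneg : ∀ t ∈ Set.Icc (0 : ℝ) 1, 0 ≤ g t) (hg_pos : ∃ t ∈ Set.Ioc (0 : ℝ) 1, 0 < g t)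
    {s : ℂ} {x : ℝ} (hx : x < s.re) :
    ‖∫ t in (0 : ℝ)..1, Complex.exp (-(t * s) * τ) * (g t : ℂ)‖ <
      ‖∫ t in (0 : ℝ)..1, Complex.exp (-(t * (x : ℂ)) * τ) * (g t : ℂ)‖ := by
  have hnorm : ∀ z : ℂ, ∀ t ∈ Set.Icc (0 : ℝ) 1,
      ‖Complex.exp (-(t * z) * τ) * (g t : ℂ)‖ = Real.exp (-(t * z.re) * τ) * g t := by
    intro z t ht
    rw [norm_mul, Complex.norm_exp, Complex.norm_of_nonneg (hg_nonneg t ht)]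
    simp
  have hreal : (∫ t in (0 : ℝ)..1, Complex.exp (-(t * (x : ℂ)) * τ) * (g t : ℂ)) =
      ((∫ t in (0 : ℝ)..1, Real.exp (-(t * x) * τ) * g t : ℝ) : ℂ) := by
    rw [← intervalIntegral.integral_ofReal]
    push_cast
    rfl
  calc ‖∫ t in (0 : ℝ)..1, Complex.exp (-(t * s) * τ) * (g t : ℂ)‖
      ≤ ∫ t in (0 : ℝ)..1, ‖Complex.exp (-(t * s) * τ) * (g t : ℂ)‖ :=
        intervalIntegral.norm_integral_le_integral_norm zero_le_one
    _ = ∫ t in (0 : ℝ)..1, Real.exp (-(t * s.re) * τ) * g t := by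
        apply intervalIntegral.integral_congr
        intro t ht
        rw [Set.uIcc_of_le zero_le_one] at ht
        exact hnorm s t ht
    _ < ∫ t in (0 : ℝ)..1, Real.exp (-(t * x) * τ) * g t := by
        apply intervalIntegral.integral_lt_integral_of_continuousOn_of_le_of_exists_lt
          zero_lt_one (Continuous.continuousOn (by fun_prop)) (Continuous.continuousOn (by fun_prop))
        · intro t ht
          have := hg_nonneg t (Set.Ioc_subset_Icc_self ht)
          have := ht.1
          rw [neg_mul, neg_mul]
          gcongr
        · obtain ⟨t, ht, hgt⟩ := hg_pos
          refine ⟨t, Set.Ioc_subset_Icc_self ht, ?_⟩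
          have := ht.1
          rw [neg_mul, neg_mul]
          gcongr
    _ ≤ _ := by
        rw [hreal, Complex.norm_real]
        exact Real.le_norm_self _

/-- CRRID for `(n, m) = (2, 0)`: if `Δ(s) = s² + a₁ s + a₀ + b₀ e^{-sτ}` admits three
distinct real roots `s₁ > s₂ > s₃`, then `s₁` is dominant. -/
theorem crrid_n2_m0 (τ : ℝ) (hτ : 0 < τ) (a₀ a₁ b₀ : ℝ) (s₁ s₂ s₃ : ℝ)
    (h12 : s₂ < s₁) (h23 : s₃ < s₂)
    (h₁ : (s₁ : ℂ) ^ 2 + (a₁ : ℂ) * s₁ + (a₀ : ℂ) + (b₀ : ℂ) * Complex.exp (-(s₁ : ℂ) * τ) = 0)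
    (h₂ : (s₂ : ℂ) ^ 2 + (a₁ : ℂ) * s₂ + (a₀ : ℂ) + (b₀ : ℂ) * Complex.exp (-(s₂ : ℂ) * τ) = 0)
    (h₃ : (s₃ : ℂ) ^ 2 + (a₁ : ℂ) * s₃ + (a₀ : ℂ) + (b₀ : ℂ) * Complex.exp (-(s₃ : ℂ) * τ) = 0) :
    ∀ s : ℂ, s ^ 2 + (a₁ : ℂ) * s + (a₀ : ℂ) + (b₀ : ℂ) * Complex.exp (-s * τ) = 0 →
      s.re ≤ s₁ := by
  intro s hs
  by_contra! hlt
  have hne : ∀ r : ℝ, r ≤ s₁ → s ≠ r := by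
    rintro r hr rfl
    exact absurd (hr.trans_lt hlt) (by simp)
  have hI := mul_integral_exp_kernel_eq_of_roots (hne s₁ le_rfl) (hne s₂ h12.le) hs h₁ h₂
  have hI₃ := mul_integral_exp_kernel_eq_of_roots (s := (s₃ : ℂ))
    (by exact_mod_cast (h23.trans h12).ne) (by exact_mod_cast h23.ne) h₃ h₁ h₂
  have hb : (b₀ : ℂ) ≠ 0 := by
    intro hb
    rw [hb, zero_mul, eq_comm, sub_eq_zero] at hI
    exact h12.ne (by exact_mod_cast hI)
  have hτ' : (τ : ℂ) ≠ 0 := by exact_mod_cast hτ.ne'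
  have heq := mul_left_cancel₀ hτ' (mul_left_cancel₀ hb (hI.trans hI₃.symm))
  refine (norm_integral_exp_mul_lt hτ
    (g := fun t ↦ Real.exp (-((1 - t) * s₂) * τ) - Real.exp (-((1 - t) * s₁) * τ))
    (by fun_prop) ?_ ⟨1 / 2, by norm_num, ?_⟩ ((h23.trans h12).trans hlt)).ne
    (congrArg _ heq)
  · intro t ht
    have := sub_nonneg.mpr ht.2
    rw [neg_mul, neg_mul, sub_nonneg]
    gcongr
  · rw [neg_mul, neg_mul, sub_pos]
    gcongr
end

section
/- Let n be a positive integer, τ > 0, and a_0, …, a_{n-1}, b_0 ∈ ℝ, and consider the quasipolynomial Δ(s) = s^n + Σ_{k=0}^{n-1} a_k s^k + b_0 e^{-sτ} (case m = 0). If Δ admits n + 1 distinct real roots s_1 > s_2 > … > s_{n+1}, then the largest one, s_1, is dominant: every root s ∈ ℂ of Δ satisfies Re s ≤ s_1. -/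
open Complex Finset

/-- `F` is the Laplace transform of a continuous function which is positive on `(0, τ)`,
restricted to `[0, τ]`. -/
def IsPositiveLaplace (τ : ℝ) (F : ℂ → ℂ) : Prop :=
  ∃ w : ℝ → ℝ, Continuous w ∧ (∀ u ∈ Set.Ioo 0 τ, 0 < w u) ∧
    ∀ z : ℂ, F z = ∫ u in (0 : ℝ)..τ, (w u : ℂ) * Complex.exp (-z * u)

/-- The negated divided difference of `z ↦ exp (-z τ)` at a real point is a positive
Laplace transform. -/
theorem exists_isPositiveLaplace_exp {τ : ℝ} (a : ℝ) :
    ∃ G, IsPositiveLaplace τ G ∧ ∀ z : ℂ,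
      Complex.exp (-z * τ) - Complex.exp (-(a : ℂ) * τ) = -((z - a) * G z) := by
  refine ⟨_, ⟨fun u ↦ Real.exp (-a * (τ - u)), by fun_prop, fun u _ ↦ Real.exp_pos _,
    fun z ↦ rfl⟩, fun z ↦ ?_⟩
  have hderiv (u : ℝ) : HasDerivAt
      (fun u : ℝ ↦ Complex.exp (-(a : ℂ) * (τ - u) + -z * u))
      (Complex.exp (-(a : ℂ) * (τ - u) + -z * u) * (a - z)) u := by
    have hu : HasDerivAt (fun u : ℝ ↦ (u : ℂ)) 1 u := (hasDerivAt_id u).ofReal_comp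
    refine (((hu.const_sub (τ : ℂ)).const_mul (-(a : ℂ))).add
      (hu.const_mul (-z))).cexp.congr_deriv ?_
    simp only [Pi.add_apply]
    ring
  have hint := intervalIntegral.integral_eq_sub_of_hasDerivAt (a := 0) (b := τ)
    (fun u _ ↦ hderiv u) (Continuous.intervalIntegrable (by fun_prop) _ _)
  rw [intervalIntegral.integral_mul_const] at hint
  simp only [sub_self, mul_zero, zero_add, Complex.ofReal_zero, sub_zero, add_zero] at hint
  rw [← hint]
  have hcongr : (∫ u in (0 : ℝ)..τ, ((Real.exp (-a * (τ - u)) : ℝ) : ℂ) * Complex.exp (-z * u)) =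
      ∫ u in (0 : ℝ)..τ, Complex.exp (-(a : ℂ) * (τ - u) + -z * u) := by
    congr 1 with u
    push_cast
    rw [← Complex.exp_add]
  rw [hcongr]
  ring

/-- Positive Laplace transforms are stable under negated divided differences. -/
theorem IsPositiveLaplace.exists_dividedDifference {τ : ℝ} {F : ℂ → ℂ}
    (hF : IsPositiveLaplace τ F) (a : ℝ) :
    ∃ G, IsPositiveLaplace τ G ∧ ∀ z : ℂ, F z - F a = -((z - a) * G z) := by
  obtain ⟨w, hw, hpos, hFw⟩ := hF
  have hcont : Continuous fun v : ℝ ↦ w v * Real.exp (-a * v) := by fun_prop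
  set I : ℝ → ℝ := fun u ↦ ∫ v in u..τ, w v * Real.exp (-a * v) with hI
  have hI' (u : ℝ) : HasDerivAt I (-(w u * Real.exp (-a * u))) u :=
    intervalIntegral.integral_hasDerivAt_left (hcont.intervalIntegrable _ _)
      (hcont.stronglyMeasurableAtFilter _ _) hcont.continuousAt
  have hIc : Continuous I := continuous_iff_continuousAt.2 fun u ↦ (hI' u).continuousAt
  refine ⟨_, ⟨fun u ↦ Real.exp (a * u) * I u, by fun_prop, fun u hu ↦ ?_, fun z ↦ rfl⟩,
    fun z ↦ ?_⟩
  · refine mul_pos (Real.exp_pos _) ?_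
    exact intervalIntegral.intervalIntegral_pos_of_pos_on (hcont.intervalIntegrable _ _)
      (fun v hv ↦ mul_pos (hpos v ⟨hu.1.trans hv.1, hv.2⟩) (Real.exp_pos _)) hu.2
  have hderiv (u : ℝ) : HasDerivAt
      (fun u : ℝ ↦ Complex.exp ((a - z) * u) * (I u : ℂ))
      ((a - z) * (((Real.exp (a * u) * I u : ℝ) : ℂ) * Complex.exp (-z * u))
        - (w u : ℂ) * Complex.exp (-z * u)) u := by
    have hu : HasDerivAt (fun u : ℝ ↦ (u : ℂ)) 1 u := (hasDerivAt_id u).ofReal_comp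
    refine (((hu.const_mul ((a : ℂ) - z)).cexp).mul (hI' u).ofReal_comp).congr_deriv ?_
    push_cast
    have h1 : Complex.exp ((a - z) * u) = Complex.exp (a * u) * Complex.exp (-z * u) := by
      rw [← Complex.exp_add]; ring_nf
    have h2 : Complex.exp (a * u) * Complex.exp (-a * u) = 1 := by
      rw [← Complex.exp_add]; simp
    rw [h1]
    linear_combination -(w u : ℂ) * Complex.exp (-z * u) * h2
  have hint := intervalIntegral.integral_eq_sub_of_hasDerivAt (a := 0) (b := τ)
    (fun u _ ↦ hderiv u) (Continuous.intervalIntegrable (by fun_prop) _ _)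
  rw [intervalIntegral.integral_sub (Continuous.intervalIntegrable (by fun_prop) _ _)
    (Continuous.intervalIntegrable (by fun_prop) _ _), intervalIntegral.integral_const_mul,
    ← hFw z] at hint
  have hI0 : ((I 0 : ℝ) : ℂ) = F a := by
    rw [hFw, hI, ← intervalIntegral.integral_ofReal]
    push_cast
    rfl
  have hIτ : I τ = 0 := intervalIntegral.integral_same
  rw [hIτ, hI0] at hint
  simp only [Complex.ofReal_zero, mul_zero, Complex.exp_zero, one_mul] at hint
  linear_combination -hint

/-- A positive Laplace transform does not take its value at a real point `x` anywhere in the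
half-plane strictly to the right of `x`. -/
theorem IsPositiveLaplace.ne_of_lt_re {τ : ℝ} (hτ : 0 < τ) {F : ℂ → ℂ}
    (hF : IsPositiveLaplace τ F) {x : ℝ} {z : ℂ} (hxz : x < z.re) : F z ≠ F x := by
  obtain ⟨w, hw, hpos, hFw⟩ := hF
  intro h
  have hx : F x = ((∫ u in (0 : ℝ)..τ, w u * Real.exp (-x * u) : ℝ) : ℂ) := by
    rw [hFw, ← intervalIntegral.integral_ofReal]
    push_cast
    rfl
  have hz : ‖F z‖ ≤ ∫ u in (0 : ℝ)..τ, |w u| * Real.exp (-z.re * u) := by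
    rw [hFw]
    refine (intervalIntegral.norm_integral_le_integral_norm hτ.le).trans_eq ?_
    congr 1 with u
    simp [Complex.norm_exp]
  have hsub : 0 < ∫ u in (0 : ℝ)..τ,
      (w u * Real.exp (-x * u) - |w u| * Real.exp (-z.re * u)) := by
    refine intervalIntegral.intervalIntegral_pos_of_pos_on
      (Continuous.intervalIntegrable (by fun_prop) _ _) (fun u hu ↦ ?_) hτ
    rw [abs_of_pos (hpos u hu), ← mul_sub]
    refine mul_pos (hpos u hu) (sub_pos.2 (Real.exp_lt_exp.2 ?_))
    nlinarith [hu.1]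
  rw [intervalIntegral.integral_sub (Continuous.intervalIntegrable (by fun_prop) _ _)
    (Continuous.intervalIntegrable (by fun_prop) _ _)] at hsub
  rw [h, hx, Complex.norm_real, Real.norm_eq_abs] at hz
  linarith [le_abs_self (∫ u in (0 : ℝ)..τ, w u * Real.exp (-x * u))]

/-- Dividing `P + b F` by `z - a` at a root `a`, where `G` is the negated divided difference
of `F` at `a`. -/
theorem exists_monic_factor {n : ℕ} {P : Polynomial ℂ} (hP : P.Monic)
    (hdeg : P.natDegree = n + 1) {a b : ℂ} {F G : ℂ → ℂ}
    (hG : ∀ z, F z - F a = -((z - a) * G z)) (ha : P.eval a + b * F a = 0) :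
    ∃ Q : Polynomial ℂ, Q.Monic ∧ Q.natDegree = n ∧
      ∀ z, P.eval z + b * F z = (z - a) * (Q.eval z + -b * G z) := by
  have hdeg' : (Polynomial.X - Polynomial.C a).degree ≤ P.degree := by
    rw [Polynomial.degree_X_sub_C, Polynomial.degree_eq_natDegree hP.ne_zero, hdeg]
    exact_mod_cast Nat.le_add_left 1 n
  refine ⟨P /ₘ (Polynomial.X - Polynomial.C a), ?_, ?_, fun z ↦ ?_⟩
  · rw [Polynomial.Monic,
      Polynomial.leadingCoeff_divByMonic_of_monic (Polynomial.monic_X_sub_C a) hdeg']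
    exact hP
  · rw [Polynomial.natDegree_divByMonic _ (Polynomial.monic_X_sub_C a), hdeg]
    simp
  · have h := congrArg (Polynomial.eval z)
      (Polynomial.modByMonic_add_div P (Polynomial.X - Polynomial.C a))
    rw [Polynomial.modByMonic_X_sub_C_eq_C_eval] at h
    simp only [Polynomial.eval_add, Polynomial.eval_C, Polynomial.eval_mul,
      Polynomial.eval_sub, Polynomial.eval_X] at h
    linear_combination -h + b * hG z + ha

/-- If `P + b F` with `P` monic of degree `n + 1` vanishes at `s 0 > ⋯ > s (n + 1)` and at a point
`z` to the right of `s 0`, its quotient by the last root vanishes at `s 0 > ⋯ > s n` and `z`. -/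
theorem exists_monic_reduction {n : ℕ} {P : Polynomial ℂ} (hP : P.Monic)
    (hdeg : P.natDegree = n + 1) {b : ℂ} {F G : ℂ → ℂ} {s : Fin (n + 2) → ℝ} (hs : StrictAnti s)
    (hG : ∀ z : ℂ, F z - F (s (Fin.last _)) = -((z - s (Fin.last _)) * G z))
    (hroots : ∀ i, P.eval (s i : ℂ) + b * F (s i) = 0)
    {z : ℂ} (hz : P.eval z + b * F z = 0) (hre : s 0 < z.re) :
    ∃ Q : Polynomial ℂ, Q.Monic ∧ Q.natDegree = n ∧
      (∀ i : Fin (n + 1), Q.eval (s i.castSucc : ℂ) + -b * G (s i.castSucc) = 0) ∧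
      Q.eval z + -b * G z = 0 := by
  obtain ⟨Q, hQ, hQdeg, hfac⟩ := exists_monic_factor hP hdeg hG (hroots _)
  refine ⟨Q, hQ, hQdeg, fun i ↦ ?_, ?_⟩
  · have h := hroots i.castSucc
    rw [hfac] at h
    refine (mul_eq_zero.1 h).resolve_left (sub_ne_zero.2 ?_)
    exact_mod_cast (hs (Fin.castSucc_lt_last i)).ne'
  · rw [hfac] at hz
    refine (mul_eq_zero.1 hz).resolve_left (sub_ne_zero.2 ?_)
    rintro rfl
    exact absurd hre (not_lt.2 (hs.antitone (Fin.zero_le _)))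

/-- If `P + b F`, with `P` monic of degree `n` and `F` a positive Laplace transform, has real
roots `s 0 > ⋯ > s n`, then `s 0` is dominant. -/
theorem IsPositiveLaplace.re_le_of_root {τ : ℝ} (hτ : 0 < τ) {n : ℕ} {P : Polynomial ℂ}
    (hP : P.Monic) (hdeg : P.natDegree = n) {b : ℂ} {F : ℂ → ℂ} (hF : IsPositiveLaplace τ F)
    {s : Fin (n + 1) → ℝ} (hs : StrictAnti s)
    (hroots : ∀ i, P.eval (s i : ℂ) + b * F (s i) = 0)
    {z : ℂ} (hz : P.eval z + b * F z = 0) : z.re ≤ s 0 := by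
  by_contra! hre
  induction n generalizing P b F with
  | zero =>
    obtain rfl := hP.natDegree_eq_zero.1 hdeg
    have h0 := hroots 0
    rw [Polynomial.eval_one] at h0 hz
    have hb : b ≠ 0 := by
      rintro rfl
      simp at hz
    exact hF.ne_of_lt_re hτ hre (mul_left_cancel₀ hb (by linear_combination hz - h0))
  | succ n ih =>
    obtain ⟨G, hGpos, hG⟩ := hF.exists_dividedDifference (s (Fin.last _))
    obtain ⟨Q, hQ, hQdeg, hQroots, hQz⟩ := exists_monic_reduction hP hdeg hs hG hroots hz hre
    exact ih hQ hQdeg hGpos (s := s ∘ Fin.castSucc) (hs.comp_strictMono Fin.strictMono_castSucc)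
      hQroots hQz hre

/-- CRRID for arbitrary `n` and `m = 0`: if `Δ(s) = sⁿ + Σ_{k<n} aₖ sᵏ + b₀ e^{-sτ}`
admits `n + 1` distinct real roots `s 0 > s 1 > … > s n`, then the largest root `s 0`
is dominant. -/
theorem crrid_m0 (n : ℕ) (hn : 0 < n) (τ : ℝ) (hτ : 0 < τ) (a : ℕ → ℝ) (b₀ : ℝ)
    (s : Fin (n + 1) → ℝ) (hs : StrictAnti s)
    (hroots : ∀ i : Fin (n + 1),
      (s i : ℂ) ^ n + (∑ k ∈ Finset.range n, (a k : ℂ) * (s i : ℂ) ^ k)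
        + (b₀ : ℂ) * Complex.exp (-(s i : ℂ) * τ) = 0) :
    ∀ z : ℂ,
      z ^ n + (∑ k ∈ Finset.range n, (a k : ℂ) * z ^ k)
        + (b₀ : ℂ) * Complex.exp (-z * τ) = 0 → z.re ≤ s 0 := by
  intro z hz
  obtain ⟨n, rfl⟩ := Nat.exists_eq_add_one.2 hn
  set R : Polynomial ℂ := ∑ k ∈ Finset.range (n + 1),
    Polynomial.C (a k : ℂ) * Polynomial.X ^ k with hR
  have hRdeg : R.degree < ((n + 1 : ℕ) : WithBot ℕ) := by
    rw [Polynomial.degree_lt_iff_coeff_zero]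
    intro m hm
    rw [hR, Polynomial.finsetSum_coeff]
    refine Finset.sum_eq_zero fun k hk ↦ ?_
    rw [Polynomial.coeff_C_mul_X_pow, if_neg]
    have := Finset.mem_range.1 hk
    omega
  have hP : (Polynomial.X ^ (n + 1) + R).Monic := Polynomial.monic_X_pow_add hRdeg
  have hdeg : (Polynomial.X ^ (n + 1) + R).natDegree = n + 1 := by
    rw [Polynomial.natDegree_add_eq_left_of_degree_lt (by rwa [Polynomial.degree_X_pow]),
      Polynomial.natDegree_X_pow]
  have heval (x : ℂ) : (Polynomial.X ^ (n + 1) + R).eval x =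
      x ^ (n + 1) + ∑ k ∈ Finset.range (n + 1), (a k : ℂ) * x ^ k := by
    simp [hR, Polynomial.eval_finsetSum]
  by_contra! hre
  obtain ⟨G, hGpos, hG⟩ := exists_isPositiveLaplace_exp (τ := τ) (s (Fin.last _))
  simp only [← heval] at hroots hz
  obtain ⟨Q, hQ, hQdeg, hQroots, hQz⟩ := exists_monic_reduction
    (F := fun z ↦ Complex.exp (-z * τ)) hP hdeg hs hG hroots hz hre
  exact hre.not_ge (hGpos.re_le_of_root hτ hQ hQdeg (s := s ∘ Fin.castSucc)
    (hs.comp_strictMono Fin.strictMono_castSucc) hQroots hQz)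
end

section
/- Let τ > 0, b_1 = 2(√2 − 1) e^{−2+√2}/τ, and b_0 = 2(5√2 − 7) e^{−2+√2}/τ². Then the quasipolynomial Δ(s) = s² + (b_1 s + b_0) e^{-sτ} of the closed-loop double integrator has spectral abscissa equal to −(2 − √2)/τ; that is, sup{Re s : s ∈ ℂ, Δ(s) = 0} = −(2 − √2)/τ, and this supremum is attained at the real triple root s_0 = −(2 − √2)/τ. -/
open Complex

/-- Integral representation of `1 - ((z - a)² + (c z - a²) e^{-z}) / z²`. -/
lemma integral_affine_mul_cexp_neg_mul (a c : ℝ) (hac : 2 * a = a ^ 2 + c) {z : ℂ} (hz : z ≠ 0) :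
    ∫ u in (0 : ℝ)..1, ((c + a ^ 2 * (1 - u) : ℝ) : ℂ) * cexp (-z * u) =
      1 - ((z - a) ^ 2 + (c * z - a ^ 2) * cexp (-z)) / z ^ 2 := by
  have hderiv : ∀ u ∈ Set.uIcc (0 : ℝ) 1,
      HasDerivAt (fun u : ℝ => (-((c + a ^ 2 * (1 - (u : ℂ))) / z) + a ^ 2 / z ^ 2) *
        cexp (-z * u)) (((c + a ^ 2 * (1 - u) : ℝ) : ℂ) * cexp (-z * u)) u := by
    intro u _
    have hexp : HasDerivAt (fun w : ℂ => cexp (-z * w)) (cexp (-z * u) * (-z * 1)) (u : ℂ) :=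
      ((hasDerivAt_id (u : ℂ)).const_mul (-z)).cexp
    have haff : HasDerivAt (fun w : ℂ => -((c + a ^ 2 * (1 - w)) / z) + a ^ 2 / z ^ 2)
        (-((a : ℂ) ^ 2 * (-1) / z)) (u : ℂ) :=
      ((((((hasDerivAt_id (u : ℂ)).const_sub 1).const_mul ((a : ℂ) ^ 2)).const_add
        (c : ℂ)).div_const z).neg).add_const _
    refine (haff.mul hexp).comp_ofReal.congr_deriv ?_
    push_cast
    field_simp
    ring
  rw [intervalIntegral.integral_eq_sub_of_hasDerivAt hderiv
    (Continuous.intervalIntegrable (by fun_prop) _ _)]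
  have hc : (c : ℂ) = 2 * a - a ^ 2 := by
    rw [show c = 2 * a - a ^ 2 by linarith]
    push_cast
    ring
  rw [hc]
  simp
  field_simp
  ring

/-- If the kernel `c + a² (1 - u)` is positive with unit mass on `[0, 1]`, then
`(z - a)² + (c z - a²) e^{-z}` has no zeros in the open right half-plane. -/
lemma re_nonpos_of_sq_add_mul_cexp_eq_zero (a c : ℝ) (hc : 0 < c) (hac : 2 * a = a ^ 2 + c)
    (hmass : c + a ^ 2 / 2 = 1) {z : ℂ}
    (hroot : (z - a) ^ 2 + (c * z - a ^ 2) * cexp (-z) = 0) : z.re ≤ 0 := by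
  by_contra! hre
  have hz : z ≠ 0 := by
    rintro rfl
    simp at hre
  have hkernel := integral_affine_mul_cexp_neg_mul a c hac hz
  rw [hroot, zero_div, sub_zero] at hkernel
  have hpos : ∀ u ∈ Set.Ioc (0 : ℝ) 1, 0 < c + a ^ 2 * (1 - u) := fun u hu => by
    have := mul_nonneg (sq_nonneg a) (sub_nonneg.2 hu.2)
    linarith
  have hle : ‖∫ u in (0 : ℝ)..1, ((c + a ^ 2 * (1 - u) : ℝ) : ℂ) * cexp (-z * u)‖ ≤
      ∫ u in (0 : ℝ)..1, (c + a ^ 2 * (1 - u)) * Real.exp (-z.re * u) := by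
    refine intervalIntegral.norm_integral_le_of_norm_le zero_le_one
      (Filter.Eventually.of_forall fun u hu => ?_)
      (Continuous.intervalIntegrable (by fun_prop) _ _)
    rw [norm_mul, Complex.norm_exp, Complex.norm_of_nonneg (hpos u hu).le]
    simp
  have hlt : ∫ u in (0 : ℝ)..1, (c + a ^ 2 * (1 - u)) * Real.exp (-z.re * u) <
      ∫ u in (0 : ℝ)..1, (c + a ^ 2 * (1 - u)) := by
    refine intervalIntegral.integral_lt_integral_of_continuousOn_of_le_of_exists_lt zero_lt_one
      (by fun_prop) (by fun_prop) (fun u hu => ?_) ⟨1, by simp, ?_⟩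
    · refine mul_le_of_le_one_right (hpos u hu).le (Real.exp_le_one_iff.2 ?_)
      nlinarith [hu.1]
    · exact mul_lt_of_lt_one_right (hpos 1 (by simp)) (Real.exp_lt_one_iff.2 (by linarith))
  have hone : ∫ u in (0 : ℝ)..1, (c + a ^ 2 * (1 - u)) = 1 := by
    have hderiv : ∀ u ∈ Set.uIcc (0 : ℝ) 1,
        HasDerivAt (fun u : ℝ => c * u + a ^ 2 * (u - u ^ 2 / 2)) (c + a ^ 2 * (1 - u)) u := by
      intro u _
      refine (((hasDerivAt_id u).const_mul c).add (((hasDerivAt_id u).sub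
        (((hasDerivAt_id u).pow 2).div_const 2)).const_mul (a ^ 2))).congr_deriv ?_
      simp
    rw [intervalIntegral.integral_eq_sub_of_hasDerivAt hderiv
      (Continuous.intervalIntegrable (by fun_prop) _ _)]
    linarith
  rw [hkernel, norm_one] at hle
  linarith

/-- Spectral abscissa of the MID-tuned double integrator: with
`b₁ = 2(√2-1)e^{-2+√2}/τ` and `b₀ = 2(5√2-7)e^{-2+√2}/τ²`, the set of real parts of
roots of `Δ(s) = s² + (b₁ s + b₀) e^{-sτ}` has greatest element `-(2-√2)/τ`, attained
at the real triple root `s₀ = -(2-√2)/τ`. -/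
theorem spectral_abscissa_double_integrator (τ : ℝ) (hτ : 0 < τ) (b₀ b₁ : ℝ)
    (hb₁ : b₁ = 2 * (Real.sqrt 2 - 1) * Real.exp (-2 + Real.sqrt 2) / τ)
    (hb₀ : b₀ = 2 * (5 * Real.sqrt 2 - 7) * Real.exp (-2 + Real.sqrt 2) / τ ^ 2) :
    IsGreatest {x : ℝ | ∃ s : ℂ,
        s ^ 2 + ((b₁ : ℂ) * s + (b₀ : ℂ)) * Complex.exp (-s * τ) = 0 ∧ s.re = x}
      (-(2 - Real.sqrt 2) / τ) ∧
    ((-(2 - Real.sqrt 2) / τ : ℂ)) ^ 2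
      + ((b₁ : ℂ) * ((-(2 - Real.sqrt 2) / τ : ℝ) : ℂ) + (b₀ : ℂ))
        * Complex.exp (-(((-(2 - Real.sqrt 2) / τ : ℝ) : ℂ)) * τ) = 0 := by
  have h2 : Real.sqrt 2 ^ 2 = 2 := Real.sq_sqrt (by norm_num)
  have h2c : (Real.sqrt 2 : ℂ) ^ 2 = 2 := by exact_mod_cast h2
  have hτc : (τ : ℂ) ≠ 0 := by exact_mod_cast hτ.ne'
  have hroot : ((-(2 - Real.sqrt 2) / τ : ℂ)) ^ 2
      + ((b₁ : ℂ) * ((-(2 - Real.sqrt 2) / τ : ℝ) : ℂ) + (b₀ : ℂ))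
        * Complex.exp (-(((-(2 - Real.sqrt 2) / τ : ℝ) : ℂ)) * τ) = 0 := by
    have hexp : -(((-(2 - Real.sqrt 2) / τ : ℝ) : ℂ)) * τ = -(-2 + Real.sqrt 2) := by
      push_cast
      field_simp
      ring
    have hne := Complex.exp_ne_zero (-2 + Real.sqrt 2)
    rw [hexp, Complex.exp_neg, hb₁, hb₀]
    push_cast
    field_simp
    linear_combination 3 * h2c
  refine ⟨⟨⟨((-(2 - Real.sqrt 2) / τ : ℝ) : ℂ), ?_, Complex.ofReal_re _⟩, ?_⟩, hroot⟩
  · rw [← hroot]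
    push_cast
    rfl
  · rintro _ ⟨s, hs, rfl⟩
    have hshift := re_nonpos_of_sq_add_mul_cexp_eq_zero (2 - Real.sqrt 2) (2 * (Real.sqrt 2 - 1))
      (by linarith [Real.one_lt_sqrt_two]) (by linarith) (by linarith)
      (z := s * τ + ((2 - Real.sqrt 2 : ℝ) : ℂ)) (by
        have hexp : cexp (-(s * τ + ((2 - Real.sqrt 2 : ℝ) : ℂ))) =
            cexp (-(s * τ)) * cexp (-2 + Real.sqrt 2) := by
          rw [← Complex.exp_add]
          push_cast
          ring_nf
        rw [hb₁, hb₀] at hs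
        rw [hexp]
        push_cast at hs ⊢
        field_simp at hs
        linear_combination hs - 3 * cexp (-(s * τ)) * cexp (-2 + Real.sqrt 2) * h2c)
    rw [le_div_iff₀ hτ]
    simp at hshift
    linarith
end
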